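/- Let {X_n, n ≥ 1} be a strictly stationary sequence of associated random variables with |X_n| ≤ C_1 < ∞ for all n, such that X_1 has a bounded density. Assume Σ_{j=1}^∞ Cov(X_1, X_j)^γ < ∞ for some 0 < γ < 1/6, and σ_U² > 0. Then √n (U_n − θ)/(2σ_U) converges in distribution to N(0,1) as n → ∞, where U_n is the Gini mean difference statistic. -/

import Mathlib

open MeasureTheory ProbabilityTheory Filter Topology

noncomputable section

variable {Ω : Type*} [MeasurableSpace Ω]

/-- Covariance of two real-valued random variables. -/
def cov (μ : Measure Ω) (f g : Ω → ℝ) : ℝ :=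
  ∫ ω, f ω * g ω ∂μ - (∫ ω, f ω ∂μ) * (∫ ω, g ω ∂μ)

/-- A family of real-valued random variables is *associated* if every two coordinatewise
nondecreasing functions of any finite subcollection have nonnegative covariance
(whenever the relevant integrals exist). -/
def IsAssociated (μ : Measure Ω) {ι : Type*} (X : ι → Ω → ℝ) : Prop :=
  ∀ (S : Finset ι) (h g : (S → ℝ) → ℝ), Monotone h → Monotone g →
    Measurable h → Measurable g →
    Integrable (fun ω => h fun i => X i ω) μ →
    Integrable (fun ω => g fun i => X i ω) μ →
    Integrable (fun ω => h (fun i => X i ω) * g (fun i => X i ω)) μ →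
    0 ≤ cov μ (fun ω => h fun i => X i ω) (fun ω => g fun i => X i ω)

/-- Strict stationarity of the sequence `X 1, X 2, ...`. -/
def StrictStationary (μ : Measure Ω) (X : ℕ → Ω → ℝ) : Prop :=
  ∀ k n : ℕ, Measure.map (fun ω => fun i : Fin n => X (1 + (i : ℕ) + k) ω) μ =
    Measure.map (fun ω => fun i : Fin n => X (1 + (i : ℕ)) ω) μ

/-- Convergence in distribution to the standard normal law `N(0,1)`. -/
def TendstoStdGaussian (μ : Measure Ω) (Z : ℕ → Ω → ℝ) : Prop :=
  ∀ f : BoundedContinuousFunction ℝ ℝ,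
    Tendsto (fun n => ∫ ω, f (Z n ω) ∂μ) atTop
      (𝓝 (∫ x, f x ∂(gaussianReal 0 1)))

/-- `ρ₁(x) = ∫ |x − y| dF(y)` where `F` is the law of `X₁`. -/
def rho1 (μ : Measure Ω) (X1 : Ω → ℝ) (x : ℝ) : ℝ := ∫ y, |x - y| ∂(μ.map X1)

/-- Gini mean difference parameter `θ = ∫∫ |x − y| dF(x) dF(y)`. -/
def giniTheta (μ : Measure Ω) (X1 : Ω → ℝ) : ℝ := ∫ x, rho1 μ X1 x ∂(μ.map X1)

/-- Degenerate part of the Gini kernel: `h⁽²⁾(x,y) = |x−y| − ρ₁(x) − ρ₁(y) + θ`. -/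
def h2 (μ : Measure Ω) (X1 : Ω → ℝ) (x y : ℝ) : ℝ :=
  |x - y| - rho1 μ X1 x - rho1 μ X1 y + giniTheta μ X1

/-- `X` has a bounded probability density (w.r.t. Lebesgue measure). -/
def HasBddDensity (μ : Measure Ω) (X : Ω → ℝ) : Prop :=
  ∃ d : ℝ → ℝ, Measurable d ∧ (∃ M : ℝ, ∀ x, d x ≤ M) ∧ (∀ x, 0 ≤ d x) ∧
    μ.map X = volume.withDensity (fun x => ENNReal.ofReal (d x))

/-- Gini's mean difference statistic
`U_n = (2/(n(n−1))) ∑_{1 ≤ i < j ≤ n} |X_i − X_j|`. -/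
def giniU (X : ℕ → Ω → ℝ) (n : ℕ) (ω : Ω) : ℝ :=
  (2 / ((n : ℝ) * ((n : ℝ) - 1))) *
    ∑ i ∈ Finset.Icc 1 n, ∑ j ∈ Finset.Icc (i + 1) n, |X i ω - X j ω|

/-- The covariance agrees with Mathlib's covariance for square integrable variables. -/
lemma cov_eq_covariance {μ : Measure Ω} [IsProbabilityMeasure μ] {f g : Ω → ℝ}
    (hf : MemLp f 2 μ) (hg : MemLp g 2 μ) : cov μ f g = covariance f g μ := by
  rw [covariance_eq_sub hf hg]
  rfl

lemma memLp_of_forall_abs_le {μ : Measure Ω} [IsFiniteMeasure μ] {f : Ω → ℝ}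
    (hf : Measurable f) {K : ℝ} (hK : ∀ ω, |f ω| ≤ K) (p : ENNReal) : MemLp f p μ :=
  MemLp.of_bound hf.aestronglyMeasurable K (.of_forall hK)

/-- Association, for functions on the space of sequences depending on finitely many
coordinates. -/
lemma IsAssociated.cov_nonneg {μ : Measure Ω} [IsProbabilityMeasure μ] {ξ : ℕ → Ω → ℝ}
    (ha : IsAssociated μ ξ) (hm : ∀ i, Measurable (ξ i)) {F G : (ℕ → ℝ) → ℝ}
    (hF : Monotone F) (hG : Monotone G) (hFm : Measurable F) (hGm : Measurable G)
    (S : Finset ℕ) (hFS : DependsOn F S) (hGS : DependsOn G S)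
    {K : ℝ} (hFb : ∀ ω, |F (fun i => ξ i ω)| ≤ K) (hGb : ∀ ω, |G (fun i => ξ i ω)| ≤ K) :
    0 ≤ cov μ (fun ω => F fun i => ξ i ω) (fun ω => G fun i => ξ i ω) := by
  let e : (S → ℝ) → ℕ → ℝ := fun x i => if h : i ∈ S then x ⟨i, h⟩ else 0
  have he : Monotone e := by
    intro x y hxy i
    by_cases h : i ∈ S
    · simpa [e, h] using hxy ⟨i, h⟩
    · simp [e, h]
  have hem : Measurable e := by
    refine measurable_pi_lambda _ fun i => ?_
    by_cases h : i ∈ S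
    · simpa [e, h] using measurable_pi_apply _
    · simp [e, h]
  have hFe : ∀ ω, F (e fun i => ξ i ω) = F (fun i => ξ i ω) := fun ω =>
    hFS fun i hi => by simp [e, Finset.mem_coe.1 hi]
  have hGe : ∀ ω, G (e fun i => ξ i ω) = G (fun i => ξ i ω) := fun ω =>
    hGS fun i hi => by simp [e, Finset.mem_coe.1 hi]
  have hξ : Measurable fun ω => fun i => ξ i ω := measurable_pi_lambda _ hm
  have h1 : MemLp (fun ω => F fun i => ξ i ω) 2 μ :=
    memLp_of_forall_abs_le (hFm.comp hξ) hFb 2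
  have h2 : MemLp (fun ω => G fun i => ξ i ω) 2 μ :=
    memLp_of_forall_abs_le (hGm.comp hξ) hGb 2
  have := ha S (F ∘ e) (G ∘ e) (hF.comp he) (hG.comp he) (hFm.comp hem) (hGm.comp hem)
  simp only [Function.comp_apply, hFe, hGe] at this
  exact this (h1.integrable one_le_two) (h2.integrable one_le_two) (h1.integrable_mul h2)

/-- Lipschitz functionals of bounded associated variables have covariance controlled by the
covariances of the variables. -/
lemma IsAssociated.abs_cov_le {μ : Measure Ω} [IsProbabilityMeasure μ] {ξ : ℕ → Ω → ℝ}
    (ha : IsAssociated μ ξ) (hm : ∀ i, Measurable (ξ i)) {C : ℝ} (hb : ∀ i ω, |ξ i ω| ≤ C)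
    {F G : (ℕ → ℝ) → ℝ} (hFm : Measurable F) (hGm : Measurable G) {I J : Finset ℕ} {L K : ℝ}
    (hL : 0 ≤ L) (hK : 0 ≤ K)
    (hF : ∀ x y, |F x - F y| ≤ L * ∑ i ∈ I, |x i - y i|)
    (hG : ∀ x y, |G x - G y| ≤ K * ∑ j ∈ J, |x j - y j|) :
    |cov μ (fun ω => F fun i => ξ i ω) (fun ω => G fun i => ξ i ω)| ≤
      L * K * ∑ i ∈ I, ∑ j ∈ J, cov μ (ξ i) (ξ j) := by
  have key : ∀ (H : (ℕ → ℝ) → ℝ), Measurable H → ∀ (A : Finset ℕ) (R : ℝ), 0 ≤ R →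
      (∀ x y, |H x - H y| ≤ R * ∑ i ∈ A, |x i - y i|) → ∀ s : ℝ, |s| ≤ 1 →
      Monotone (fun x => R * ∑ i ∈ A, x i + s * H x) ∧
      Measurable (fun x => R * ∑ i ∈ A, x i + s * H x) ∧
      DependsOn (fun x => R * ∑ i ∈ A, x i + s * H x) A ∧
      (∃ B, ∀ ω, |H fun i => ξ i ω| ≤ B) ∧
      ∃ B, ∀ ω, |R * ∑ i ∈ A, ξ i ω + s * H fun i => ξ i ω| ≤ B := by
    intro H hHm A R hR hH s hs
    have hB : ∀ ω, |H fun i => ξ i ω| ≤ |H 0| + R * ∑ i ∈ A, C := by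
      intro ω
      have h1 := hH (fun i => ξ i ω) 0
      have h2 : R * ∑ i ∈ A, |ξ i ω - (0 : ℕ → ℝ) i| ≤ R * ∑ i ∈ A, C := by
        gcongr with i hi
        simpa using hb i ω
      have h3 := abs_sub_abs_le_abs_sub (H fun i => ξ i ω) (H 0)
      linarith
    refine ⟨?_, by fun_prop, ?_, ⟨_, hB⟩, R * ∑ i ∈ A, C + (|H 0| + R * ∑ i ∈ A, C), ?_⟩
    · intro x y hxy
      have h1 := hH x y
      have h2 : ∑ i ∈ A, |x i - y i| = ∑ i ∈ A, y i - ∑ i ∈ A, x i := by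
        rw [← Finset.sum_sub_distrib]
        refine Finset.sum_congr rfl fun i _ => ?_
        rw [abs_sub_comm, abs_of_nonneg (sub_nonneg.2 (hxy i))]
      rw [h2] at h1
      have h3 : |s * (H x - H y)| ≤ |H x - H y| := by
        rw [abs_mul]
        exact mul_le_of_le_one_left (abs_nonneg _) hs
      have h4 := le_abs_self (s * (H x - H y))
      simp only
      linarith
    · intro x y hxy
      have h1 : ∑ i ∈ A, |x i - y i| = 0 := Finset.sum_eq_zero fun i hi => by
        simp [hxy i hi]
      have h2 := hH x y
      rw [h1, mul_zero] at h2
      have h3 : H x = H y := sub_eq_zero.1 (abs_nonpos_iff.1 h2)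
      have h4 : ∑ i ∈ A, x i = ∑ i ∈ A, y i := Finset.sum_congr rfl fun i hi => hxy i hi
      simp only [h3, h4]
    · intro ω
      refine (abs_add_le _ _).trans (add_le_add ?_ ?_)
      · rw [abs_mul, abs_of_nonneg hR]
        gcongr
        exact (Finset.abs_sum_le_sum_abs _ _).trans (Finset.sum_le_sum fun i _ => hb i ω)
      · rw [abs_mul]
        exact (mul_le_of_le_one_left (abs_nonneg _) hs).trans (hB ω)
  have hξ : Measurable fun ω => fun i => ξ i ω := measurable_pi_lambda _ hm
  have hξL : ∀ i, MemLp (ξ i) 2 μ := fun i => memLp_of_forall_abs_le (hm i) (hb i) 2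
  have hA : MemLp (fun ω => L * ∑ i ∈ I, ξ i ω) 2 μ :=
    (memLp_finsetSum I fun i _ => hξL i).const_mul L
  have hB : MemLp (fun ω => K * ∑ i ∈ J, ξ i ω) 2 μ :=
    (memLp_finsetSum J fun i _ => hξL i).const_mul K
  obtain ⟨-, -, -, ⟨BF, hBF⟩, -⟩ := key F hFm I L hL hF 0 (by simp)
  obtain ⟨-, -, -, ⟨BG, hBG⟩, -⟩ := key G hGm J K hK hG 0 (by simp)
  have hFL : MemLp (fun ω => F fun i => ξ i ω) 2 μ :=
    memLp_of_forall_abs_le (hFm.comp hξ) hBF 2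
  have hGL : MemLp (fun ω => G fun i => ξ i ω) 2 μ :=
    memLp_of_forall_abs_le (hGm.comp hξ) hBG 2
  have pos : ∀ s t : ℝ, |s| ≤ 1 → |t| ≤ 1 →
      0 ≤ covariance (fun ω => L * ∑ i ∈ I, ξ i ω) (fun ω => K * ∑ i ∈ J, ξ i ω) μ +
        t * covariance (fun ω => L * ∑ i ∈ I, ξ i ω) (fun ω => G fun i => ξ i ω) μ +
        s * covariance (fun ω => F fun i => ξ i ω) (fun ω => K * ∑ i ∈ J, ξ i ω) μ +
        s * t * covariance (fun ω => F fun i => ξ i ω) (fun ω => G fun i => ξ i ω) μ := by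
    intro s t hs ht
    obtain ⟨a1, a2, a3, -, B1, a4⟩ := key F hFm I L hL hF s hs
    obtain ⟨b1, b2, b3, -, B2, b4⟩ := key G hGm J K hK hG t ht
    have := ha.cov_nonneg hm a1 b1 a2 b2 (I ∪ J)
      (fun x y h => a3 fun i hi => h i (by simp_all))
      (fun x y h => b3 fun i hi => h i (by simp_all))
      (fun ω => (a4 ω).trans (le_max_left B1 B2)) (fun ω => (b4 ω).trans (le_max_right B1 B2))
    have hsF : MemLp (fun ω => s * F fun i => ξ i ω) 2 μ := hFL.const_mul s
    have htG : MemLp (fun ω => t * G fun i => ξ i ω) 2 μ := hGL.const_mul t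
    replace this := this.trans_eq (cov_eq_covariance (hA.add hsF) (hB.add htG))
    have e1 : covariance (fun ω => L * ∑ i ∈ I, ξ i ω + s * F fun i => ξ i ω)
        (fun ω => K * ∑ i ∈ J, ξ i ω + t * G fun i => ξ i ω) μ = _ :=
      covariance_add_left (X := fun ω => L * ∑ i ∈ I, ξ i ω)
        (Y := fun ω => s * F fun i => ξ i ω) hA hsF (hB.add htG)
    have e2 := covariance_add_right hA hB htG
    have e3 := covariance_add_right hsF hB htG
    have e4 := covariance_const_mul_left (X := fun ω => F fun i => ξ i ω)
      (Y := fun ω => K * ∑ i ∈ J, ξ i ω) (μ := μ) s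
    have e5 := covariance_const_mul_left (X := fun ω => F fun i => ξ i ω)
      (Y := fun ω => t * G fun i => ξ i ω) (μ := μ) s
    have e6 := covariance_const_mul_right (X := fun ω => F fun i => ξ i ω)
      (Y := fun ω => G fun i => ξ i ω) (μ := μ) t
    have e7 := covariance_const_mul_right (X := fun ω => L * ∑ i ∈ I, ξ i ω)
      (Y := fun ω => G fun i => ξ i ω) (μ := μ) t
    rw [e6] at e5
    have e8 := this.trans_eq (e1.trans (congrArg₂ (· + ·) e2 e3))
    simp only [e4, e5, e7] at e8
    linarith
  have hsum : covariance (fun ω => L * ∑ i ∈ I, ξ i ω) (fun ω => K * ∑ i ∈ J, ξ i ω) μ =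
      L * K * ∑ i ∈ I, ∑ j ∈ J, cov μ (ξ i) (ξ j) := by
    rw [covariance_const_mul_left, covariance_const_mul_right,
      covariance_fun_sum_fun_sum' (fun i _ => hξL i) (fun i _ => hξL i), mul_assoc]
    simp_rw [fun i j => cov_eq_covariance (hξL i) (hξL j)]
  rw [← hsum, cov_eq_covariance hFL hGL, abs_le]
  have p1 := pos 1 1 (by simp) (by simp)
  have p2 := pos (-1) (-1) (by simp) (by simp)
  have p3 := pos 1 (-1) (by simp) (by simp)
  have p4 := pos (-1) 1 (by simp) (by simp)
  constructor <;> linarith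

lemma integral_cexp_mul_I {μ : Measure Ω} [IsFiniteMeasure μ] {f : Ω → ℝ} (hf : Measurable f) :
    ∫ ω, Complex.exp (f ω * Complex.I) ∂μ =
      (∫ ω, Real.cos (f ω) ∂μ : ℝ) + (∫ ω, Real.sin (f ω) ∂μ : ℝ) * Complex.I := by
  have h1 : Integrable (fun ω => Real.cos (f ω)) μ :=
    (memLp_of_forall_abs_le (by fun_prop) (fun ω => Real.abs_cos_le_one _) 1).integrable le_rfl
  have h2 : Integrable (fun ω => Real.sin (f ω)) μ :=
    (memLp_of_forall_abs_le (by fun_prop) (fun ω => Real.abs_sin_le_one _) 1).integrable le_rfl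
  simp_rw [Complex.exp_mul_I, ← Complex.ofReal_cos, ← Complex.ofReal_sin]
  rw [integral_add h1.ofReal (h2.ofReal.mul_const _), integral_mul_const, integral_complex_ofReal,
    integral_complex_ofReal]

lemma norm_cexp_mul_I_sub_le (x y : ℝ) :
    ‖Complex.exp (x * Complex.I) - Complex.exp (y * Complex.I)‖ ≤ |x - y| := by
  have h : Complex.exp (x * Complex.I) - Complex.exp (y * Complex.I) =
      Complex.exp (y * Complex.I) * (Complex.exp (Complex.I * (x - y : ℝ)) - 1) := by
    rw [mul_sub, ← Complex.exp_add, mul_one]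
    push_cast
    ring_nf
  rw [h, norm_mul, Complex.norm_exp_ofReal_mul_I, one_mul]
  exact Real.norm_exp_I_mul_ofReal_sub_one_le

lemma integrable_cexp_mul_I {μ : Measure Ω} [IsFiniteMeasure μ] {f : Ω → ℝ}
    (hf : Measurable f) : Integrable (fun ω => Complex.exp (f ω * Complex.I)) μ :=
  (integrable_const (1 : ℝ)).mono' (by fun_prop) (.of_forall fun ω => by
    rw [Complex.norm_exp_ofReal_mul_I])

lemma norm_integral_cexp_mul_I_le_one {μ : Measure Ω} [IsProbabilityMeasure μ] (f : Ω → ℝ) :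
    ‖∫ ω, Complex.exp (f ω * Complex.I) ∂μ‖ ≤ 1 := by
  refine (norm_integral_le_integral_norm _).trans ?_
  simp [Complex.norm_exp_ofReal_mul_I]

/-- Characteristic functions are Lipschitz with respect to the `L¹` distance. -/
lemma norm_integral_cexp_sub_le {μ : Measure Ω} [IsFiniteMeasure μ] {f g : Ω → ℝ}
    (hf : Measurable f) (hg : Measurable g) (hfg : Integrable (fun ω => |f ω - g ω|) μ) :
    ‖∫ ω, Complex.exp (f ω * Complex.I) ∂μ - ∫ ω, Complex.exp (g ω * Complex.I) ∂μ‖ ≤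
      ∫ ω, |f ω - g ω| ∂μ := by
  rw [← integral_sub (integrable_cexp_mul_I hf) (integrable_cexp_mul_I hg)]
  exact norm_integral_le_of_norm_le hfg (.of_forall fun ω => norm_cexp_mul_I_sub_le _ _)

/-- Newman's inequality for the joint characteristic function of two sums of Lipschitz
functions of associated variables. -/
lemma IsAssociated.norm_integral_cexp_add_sub_le {μ : Measure Ω} [IsProbabilityMeasure μ]
    {ξ : ℕ → Ω → ℝ} (ha : IsAssociated μ ξ) (hm : ∀ i, Measurable (ξ i)) {C : ℝ}
    (hb : ∀ i ω, |ξ i ω| ≤ C) {φ : ℝ → ℝ} (hφm : Measurable φ)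
    (hφ : ∀ x y, |φ x - φ y| ≤ |x - y|) (τ : ℝ) (I J : Finset ℕ) :
    ‖∫ ω, Complex.exp ((τ * (∑ i ∈ I, φ (ξ i ω) + ∑ j ∈ J, φ (ξ j ω)) : ℝ) * Complex.I) ∂μ -
      (∫ ω, Complex.exp ((τ * ∑ i ∈ I, φ (ξ i ω) : ℝ) * Complex.I) ∂μ) *
      ∫ ω, Complex.exp ((τ * ∑ j ∈ J, φ (ξ j ω) : ℝ) * Complex.I) ∂μ‖ ≤
      4 * τ ^ 2 * ∑ i ∈ I, ∑ j ∈ J, cov μ (ξ i) (ξ j) := by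
  have hLip : ∀ p : ℝ → ℝ, (∀ x y, |p x - p y| ≤ |x - y|) → ∀ (A : Finset ℕ) (x y : ℕ → ℝ),
      |p (τ * ∑ i ∈ A, φ (x i)) - p (τ * ∑ i ∈ A, φ (y i))| ≤ |τ| * ∑ i ∈ A, |x i - y i| := by
    intro p hp A x y
    refine (hp _ _).trans ?_
    rw [← mul_sub, abs_mul, ← Finset.sum_sub_distrib]
    gcongr
    exact (Finset.abs_sum_le_sum_abs _ _).trans (Finset.sum_le_sum fun i _ => hφ _ _)
  have hcos : ∀ x y : ℝ, |Real.cos x - Real.cos y| ≤ |x - y| := fun x y => by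
    have := Real.lipschitzWith_cos.dist_le_mul x y
    simpa [Real.dist_eq] using this
  have hsin : ∀ x y : ℝ, |Real.sin x - Real.sin y| ≤ |x - y| := fun x y => by
    have := Real.lipschitzWith_sin.dist_le_mul x y
    simpa [Real.dist_eq] using this
  let A : Ω → ℝ := fun ω => τ * ∑ i ∈ I, φ (ξ i ω)
  let B : Ω → ℝ := fun ω => τ * ∑ i ∈ J, φ (ξ i ω)
  have hAm : Measurable A := by fun_prop
  have hBm : Measurable B := by fun_prop
  have hpq : ∀ p q : ℝ → ℝ, Measurable p → Measurable q →
      (∀ x y, |p x - p y| ≤ |x - y|) → (∀ x y, |q x - q y| ≤ |x - y|) →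
      |cov μ (fun ω => p (A ω)) (fun ω => q (B ω))| ≤
        τ ^ 2 * ∑ i ∈ I, ∑ j ∈ J, cov μ (ξ i) (ξ j) := by
    intro p q hpm hqm hp hq
    have := ha.abs_cov_le hm hb (F := fun x => p (τ * ∑ i ∈ I, φ (x i)))
      (G := fun x => q (τ * ∑ i ∈ J, φ (x i))) (by fun_prop) (by fun_prop)
      (abs_nonneg τ) (abs_nonneg τ) (hLip p hp I) (hLip q hq J)
    rwa [abs_mul_abs_self, ← sq] at this
  change ‖∫ ω, Complex.exp ((τ * (∑ i ∈ I, φ (ξ i ω) + ∑ j ∈ J, φ (ξ j ω)) : ℝ) * Complex.I) ∂μ -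
    (∫ ω, Complex.exp (A ω * Complex.I) ∂μ) * ∫ ω, Complex.exp (B ω * Complex.I) ∂μ‖ ≤ _
  generalize ∑ i ∈ I, ∑ j ∈ J, cov μ (ξ i) (ξ j) = V at hpq ⊢
  have c1 := hpq _ _ Real.measurable_cos Real.measurable_cos hcos hcos
  have c2 := hpq _ _ Real.measurable_sin Real.measurable_sin hsin hsin
  have c3 := hpq _ _ Real.measurable_sin Real.measurable_cos hsin hcos
  have c4 := hpq _ _ Real.measurable_cos Real.measurable_sin hcos hsin
  have hint : ∀ p q : ℝ → ℝ, Measurable p → Measurable q → (∀ x, |p x| ≤ 1) →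
      (∀ x, |q x| ≤ 1) → Integrable (fun ω => p (A ω) * q (B ω)) μ := by
    intro p q hp hq hp1 hq1
    refine (memLp_of_forall_abs_le (K := 1) (by fun_prop) (fun ω => ?_) 1).integrable le_rfl
    rw [abs_mul]
    exact mul_le_one₀ (hp1 _) (abs_nonneg _) (hq1 _)
  have e1 : ∀ ω, (τ * (∑ i ∈ I, φ (ξ i ω) + ∑ j ∈ J, φ (ξ j ω)) : ℝ) = A ω + B ω := fun ω =>
    mul_add _ _ _
  simp_rw [e1]
  rw [integral_cexp_mul_I hAm, integral_cexp_mul_I hBm,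
    integral_cexp_mul_I (f := fun ω => A ω + B ω) (hAm.add hBm)]
  simp_rw [Real.cos_add, Real.sin_add]
  rw [integral_sub (hint _ _ Real.measurable_cos Real.measurable_cos Real.abs_cos_le_one
      Real.abs_cos_le_one) (hint _ _ Real.measurable_sin Real.measurable_sin Real.abs_sin_le_one
      Real.abs_sin_le_one),
    integral_add (hint _ _ Real.measurable_sin Real.measurable_cos Real.abs_sin_le_one
      Real.abs_cos_le_one) (hint _ _ Real.measurable_cos Real.measurable_sin Real.abs_cos_le_one
      Real.abs_sin_le_one)]
  simp only [cov] at c1 c2 c3 c4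
  refine (Complex.norm_le_abs_re_add_abs_im _).trans ?_
  simp only [Complex.sub_re, Complex.add_re, Complex.ofReal_re, Complex.mul_re, Complex.I_re,
    Complex.ofReal_im, Complex.I_im, Complex.sub_im, Complex.add_im, Complex.mul_im, mul_zero,
    add_zero, zero_add, mul_one, sub_self]
  rw [abs_le] at c1 c2 c3 c4
  have d1 : ∀ x y s : ℝ, x ≤ s → -s ≤ x → y ≤ s → -s ≤ y → |x| + |y| ≤ 2 * s := by
    intro x y s h1 h2 h3 h4
    linarith [abs_le.2 ⟨h2, h1⟩, abs_le.2 ⟨h4, h3⟩]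
  rw [show 4 * τ ^ 2 * V = 2 * (2 * (τ ^ 2 * V)) by ring]
  apply d1 <;> linarith [c1.1, c1.2, c2.1, c2.2, c3.1, c3.2, c4.1, c4.2]

/-- All finite-dimensional distributions of the sequence are invariant under shifts. -/
def ShiftInvariant (μ : Measure Ω) (ξ : ℕ → Ω → ℝ) : Prop :=
  ∀ k n : ℕ, Measure.map (fun ω => fun i : Fin n => ξ (i + k) ω) μ =
    Measure.map (fun ω => fun i : Fin n => ξ i ω) μ

lemma ShiftInvariant.integral_eq {μ : Measure Ω} {ξ : ℕ → Ω → ℝ} (hs : ShiftInvariant μ ξ)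
    (hm : ∀ i, Measurable (ξ i)) {E : Type*} [NormedAddCommGroup E] [NormedSpace ℝ E]
    (k n : ℕ) {F : (Fin n → ℝ) → E} (hF : StronglyMeasurable F) :
    ∫ ω, F (fun i => ξ (i + k) ω) ∂μ = ∫ ω, F (fun i => ξ i ω) ∂μ := by
  have h1 : Measurable fun ω => fun i : Fin n => ξ (i + k) ω :=
    measurable_pi_lambda _ fun i => hm _
  have h2 : Measurable fun ω => fun i : Fin n => ξ i ω := measurable_pi_lambda _ fun i => hm _
  rw [← integral_map h1.aemeasurable hF.aestronglyMeasurable,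
    ← integral_map h2.aemeasurable hF.aestronglyMeasurable, hs k n]

lemma ShiftInvariant.integral_comp_eq {μ : Measure Ω} {ξ : ℕ → Ω → ℝ}
    (hs : ShiftInvariant μ ξ) (hm : ∀ i, Measurable (ξ i)) {f : ℝ → ℝ} (hf : Measurable f)
    (k : ℕ) : ∫ ω, f (ξ k ω) ∂μ = ∫ ω, f (ξ 0 ω) ∂μ := by
  have := hs.integral_eq hm k 1 (F := fun x => f (x 0)) (by
    exact (hf.comp (measurable_pi_apply 0)).stronglyMeasurable)
  simpa using this

lemma ShiftInvariant.integral_mul_eq {μ : Measure Ω} {ξ : ℕ → Ω → ℝ}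
    (hs : ShiftInvariant μ ξ) (hm : ∀ i, Measurable (ξ i)) {f g : ℝ → ℝ} (hf : Measurable f)
    (hg : Measurable g) (k d : ℕ) :
    ∫ ω, f (ξ k ω) * g (ξ (k + d) ω) ∂μ = ∫ ω, f (ξ 0 ω) * g (ξ d ω) ∂μ := by
  have := hs.integral_eq hm k (d + 1) (F := fun x => f (x 0) * g (x (Fin.last d))) (by
    exact ((hf.comp (measurable_pi_apply 0)).mul
      (hg.comp (measurable_pi_apply _))).stronglyMeasurable)
  simpa [add_comm d k] using this

lemma ShiftInvariant.cov_eq {μ : Measure Ω} {ξ : ℕ → Ω → ℝ}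
    (hs : ShiftInvariant μ ξ) (hm : ∀ i, Measurable (ξ i)) (k d : ℕ) :
    cov μ (ξ k) (ξ (k + d)) = cov μ (ξ 0) (ξ d) := by
  have h1 := hs.integral_mul_eq hm measurable_id measurable_id k d
  have h2 := hs.integral_comp_eq hm measurable_id k
  have h3 := hs.integral_comp_eq hm measurable_id (k + d)
  have h4 := hs.integral_comp_eq hm measurable_id d
  simp only [id_eq] at h1 h2 h3 h4
  rw [cov, cov, h1, h2, h3, h4]

/-- The covariances between a block of `ℓ` variables and all preceding ones. -/
lemma ShiftInvariant.sum_cov_block_le {μ : Measure Ω} {ξ : ℕ → Ω → ℝ}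
    (hs : ShiftInvariant μ ξ) (hm : ∀ i, Measurable (ξ i))
    (hnn : ∀ d, 0 ≤ cov μ (ξ 0) (ξ d)) (hsum : Summable fun d => cov μ (ξ 0) (ξ d)) (N ℓ : ℕ) :
    ∑ i ∈ Finset.range N, ∑ j ∈ Finset.Ico N (N + ℓ), cov μ (ξ i) (ξ j) ≤
      ∑ k ∈ Finset.range ℓ, ∑' d, cov μ (ξ 0) (ξ (d + (k + 1))) := by
  rw [Finset.sum_comm, Finset.sum_Ico_eq_sum_range, Nat.add_sub_cancel_left]
  refine Finset.sum_le_sum fun k _ => ?_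
  rw [← Finset.sum_range_reflect]
  have h1 : ∀ i ∈ Finset.range N, cov μ (ξ (N - 1 - i)) (ξ (N + k)) =
      cov μ (ξ 0) (ξ (i + (k + 1))) := by
    intro i hi
    rw [Finset.mem_range] at hi
    rw [← hs.cov_eq hm (N - 1 - i) (i + (k + 1))]
    congr 2
    omega
  rw [Finset.sum_congr rfl h1]
  exact ((summable_nat_add_iff (k + 1)).2 hsum).sum_le_tsum _ fun d _ => hnn _

lemma tendsto_cesaro_tsum_tail {c : ℕ → ℝ} :
    Tendsto (fun ℓ : ℕ => (ℓ : ℝ)⁻¹ * ∑ k ∈ Finset.range ℓ, ∑' d, c (d + (k + 1))) atTop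
      (𝓝 0) :=
  ((tendsto_sum_nat_add c).comp (tendsto_add_atTop_nat 1)).cesaro

/-- The characteristic function of a sum of `m` blocks of length `ℓ` is close to the `m`-th power
of that of a single block. -/
lemma IsAssociated.norm_integral_cexp_blocks_sub_pow_le {μ : Measure Ω} [IsProbabilityMeasure μ]
    {ξ : ℕ → Ω → ℝ} (ha : IsAssociated μ ξ) (hm : ∀ i, Measurable (ξ i)) {C : ℝ}
    (hb : ∀ i ω, |ξ i ω| ≤ C) (hs : ShiftInvariant μ ξ)
    (hnn : ∀ d, 0 ≤ cov μ (ξ 0) (ξ d)) (hsum : Summable fun d => cov μ (ξ 0) (ξ d))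
    {φ : ℝ → ℝ} (hφm : Measurable φ) (hφ : ∀ x y, |φ x - φ y| ≤ |x - y|) (τ : ℝ) (ℓ m : ℕ) :
    ‖∫ ω, Complex.exp ((τ * ∑ i ∈ Finset.range (m * ℓ), φ (ξ i ω) : ℝ) * Complex.I) ∂μ -
      (∫ ω, Complex.exp ((τ * ∑ i ∈ Finset.range ℓ, φ (ξ i ω) : ℝ) * Complex.I) ∂μ) ^ m‖ ≤
      m * (4 * τ ^ 2 * ∑ k ∈ Finset.range ℓ, ∑' d, cov μ (ξ 0) (ξ (d + (k + 1)))) := by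
  set ψ := ∫ ω, Complex.exp ((τ * ∑ i ∈ Finset.range ℓ, φ (ξ i ω) : ℝ) * Complex.I) ∂μ with hψ
  have hψ1 : ‖ψ‖ ≤ 1 := norm_integral_cexp_mul_I_le_one _
  induction m with
  | zero => simp
  | succ m ih =>
    have h1 := ha.norm_integral_cexp_add_sub_le hm hb hφm hφ τ (Finset.range (m * ℓ))
      (Finset.Ico (m * ℓ) (m * ℓ + ℓ))
    simp_rw [Finset.sum_range_add_sum_Ico _ (Nat.le_add_right (m * ℓ) ℓ)] at h1
    have h2 : ∫ ω, Complex.exp ((τ * ∑ j ∈ Finset.Ico (m * ℓ) (m * ℓ + ℓ), φ (ξ j ω) : ℝ) *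
        Complex.I) ∂μ = ψ := by
      have h3 := hs.integral_eq hm (m * ℓ) ℓ
        (F := fun x => Complex.exp ((τ * ∑ i, φ (x i) : ℝ) * Complex.I)) (by
          refine Measurable.stronglyMeasurable ?_
          fun_prop)
      rw [hψ]
      simp_rw [Finset.sum_Ico_eq_sum_range, Nat.add_sub_cancel_left,
        Finset.sum_range, add_comm (m * ℓ)]
      exact h3
    rw [h2] at h1
    have h4 := hs.sum_cov_block_le hm hnn hsum (m * ℓ) ℓ
    have h5 := h1.trans (mul_le_mul_of_nonneg_left h4 (by positivity))
    rw [add_mul, one_mul]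
    set E := ∫ ω, Complex.exp ((τ * ∑ i ∈ Finset.range (m * ℓ), φ (ξ i ω) : ℝ) * Complex.I) ∂μ
    rw [show ∀ z : ℂ, z - ψ ^ (m + 1) = (z - E * ψ) + (E - ψ ^ m) * ψ by intro z; ring]
    refine (norm_add_le _ _).trans ?_
    rw [norm_mul]
    have h6 := mul_le_of_le_one_right (norm_nonneg (E - ψ ^ m)) hψ1
    rw [Nat.cast_succ]
    linarith

/-- The variances of the partial sums of a shift invariant sequence grow linearly. -/
lemma ShiftInvariant.tendsto_integral_sq_div {μ : Measure Ω} [IsProbabilityMeasure μ]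
    {ξ : ℕ → Ω → ℝ} (hm : ∀ i, Measurable (ξ i)) (hs : ShiftInvariant μ ξ)
    {φ : ℝ → ℝ} (hφm : Measurable φ) {B : ℝ} (hφB : ∀ i ω, |φ (ξ i ω)| ≤ B)
    (hsum : Summable fun d => ∫ ω, φ (ξ 0 ω) * φ (ξ (d + 1) ω) ∂μ) :
    Tendsto (fun ℓ : ℕ => (ℓ : ℝ)⁻¹ * ∫ ω, (∑ i ∈ Finset.range ℓ, φ (ξ i ω)) ^ 2 ∂μ) atTop
      (𝓝 (∫ ω, φ (ξ 0 ω) * φ (ξ 0 ω) ∂μ + 2 * ∑' d, ∫ ω, φ (ξ 0 ω) * φ (ξ (d + 1) ω) ∂μ)) := by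
  have hL : ∀ i, MemLp (fun ω => φ (ξ i ω)) 2 μ := fun i =>
    memLp_of_forall_abs_le (hφm.comp (hm i)) (hφB i) 2
  have hSL : ∀ N, MemLp (fun ω => ∑ i ∈ Finset.range N, φ (ξ i ω)) 2 μ := fun N =>
    memLp_finsetSum _ fun i _ => hL i
  have key : ∀ ℓ : ℕ, ∫ ω, (∑ i ∈ Finset.range ℓ, φ (ξ i ω)) ^ 2 ∂μ =
      ∑ k ∈ Finset.range ℓ, (∫ ω, φ (ξ 0 ω) * φ (ξ 0 ω) ∂μ +
        2 * ∑ d ∈ Finset.range k, ∫ ω, φ (ξ 0 ω) * φ (ξ (d + 1) ω) ∂μ) := by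
    intro ℓ
    induction ℓ with
    | zero => simp
    | succ N ih =>
      rw [Finset.sum_range_succ, ← ih]
      have e1 : ∀ ω, (∑ i ∈ Finset.range (N + 1), φ (ξ i ω)) ^ 2 =
          (∑ i ∈ Finset.range N, φ (ξ i ω)) ^ 2 + (φ (ξ N ω) * φ (ξ N ω) +
            2 * ∑ i ∈ Finset.range N, φ (ξ i ω) * φ (ξ N ω)) := by
        intro ω
        rw [Finset.sum_range_succ, ← Finset.sum_mul]
        ring
      simp_rw [e1]
      have i1 : Integrable (fun ω => (∑ i ∈ Finset.range N, φ (ξ i ω)) ^ 2) μ :=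
        (hSL N).integrable_sq
      have i2 : ∀ i, Integrable (fun ω => φ (ξ i ω) * φ (ξ N ω)) μ := fun i =>
        (hL i).integrable_mul (hL N)
      have i3 : Integrable (fun ω => ∑ i ∈ Finset.range N, φ (ξ i ω) * φ (ξ N ω)) μ :=
        integrable_finsetSum _ fun i _ => i2 i
      have i4 : Integrable (fun ω => φ (ξ N ω) * φ (ξ N ω) +
          2 * ∑ i ∈ Finset.range N, φ (ξ i ω) * φ (ξ N ω)) μ := (i2 N).add (i3.const_mul 2)
      rw [integral_add i1 i4, integral_add (i2 N) (i3.const_mul 2),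
        integral_const_mul, integral_finsetSum _ fun i _ => i2 i]
      have e2 := hs.integral_mul_eq hm hφm hφm N 0
      rw [add_zero] at e2
      rw [e2]
      congr 3
      rw [← Finset.sum_range_reflect]
      refine Finset.sum_congr rfl fun d hd => ?_
      rw [Finset.mem_range] at hd
      rw [← hs.integral_mul_eq hm hφm hφm (N - 1 - d) (d + 1)]
      rw [show N - 1 - d + (d + 1) = N by omega]
  simp_rw [key]
  exact (tendsto_const_nhds.add (hsum.hasSum.tendsto_sum_nat.const_mul 2)).cesaro

lemma tendsto_integral_cexp_div_sqrt_pow {μ : Measure Ω} [IsProbabilityMeasure μ] {S : Ω → ℝ}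
    (hS : Measurable S) (h0 : ∫ ω, S ω ∂μ = 0) (hv : 0 < ∫ ω, S ω ^ 2 ∂μ) {ℓ : ℕ} (hℓ : 0 < ℓ)
    (t : ℝ) :
    Tendsto (fun m : ℕ =>
      (∫ ω, Complex.exp ((t / √((m * ℓ : ℕ) : ℝ) * S ω : ℝ) * Complex.I) ∂μ) ^ m) atTop
      (𝓝 (Complex.exp (-(t ^ 2 * ((ℓ : ℝ)⁻¹ * ∫ ω, S ω ^ 2 ∂μ) / 2 : ℝ)))) := by
  set v := ∫ ω, S ω ^ 2 ∂μ with hvdef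
  have hX : Measurable fun ω => S ω / √v := hS.div_const _
  have h1 : μ[(fun ω => S ω / √v) ^ 2] = 1 := by
    simp only [Pi.pow_apply, div_pow, Real.sq_sqrt hv.le, integral_div]
    exact div_self hv.ne'
  have h2 : μ[fun ω => S ω / √v] = 0 := by
    simp [integral_div, h0]
  have hℓ' : (0 : ℝ) < ℓ := by exact_mod_cast hℓ
  have key := tendsto_charFun_inv_sqrt_mul_pow hX.aemeasurable h2 h1 (t * (√v / √ℓ))
  have e1 : -(((t * (√v / √ℓ) : ℝ) : ℂ)) ^ 2 / 2 =
      (-(t ^ 2 * ((ℓ : ℝ)⁻¹ * v) / 2) : ℝ) := by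
    rw [← Complex.ofReal_pow, mul_pow, div_pow, Real.sq_sqrt hv.le, Real.sq_sqrt hℓ'.le]
    push_cast
    ring
  rw [e1] at key
  refine (by simpa using key : Tendsto _ _ _).congr fun m => ?_
  congr 1
  rw [charFun_apply_real, integral_map hX.aemeasurable (by fun_prop)]
  congr 1
  ext ω
  congr 2
  have hv' : √v ≠ 0 := (Real.sqrt_pos.2 hv).ne'
  have : t / √((m * ℓ : ℕ) : ℝ) * S ω = (√(m : ℝ))⁻¹ * (t * (√v / √ℓ)) * (S ω / √v) := by
    rw [Nat.cast_mul, Real.sqrt_mul (Nat.cast_nonneg m)]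
    have : (√v / √ℓ) * (S ω / √v) = S ω / √ℓ := by field_simp
    rw [mul_assoc, mul_assoc t, this]
    field_simp
  rw [this]
  push_cast
  ring

/-- Normalized partial sums of a bounded sequence vary slowly. -/
lemma abs_sum_div_sqrt_sub_le {x : ℕ → ℝ} {B : ℝ} (hB : ∀ i, |x i| ≤ B) {k n : ℕ} (hkn : k ≤ n) :
    |(∑ i ∈ Finset.range n, x i) / √n - (∑ i ∈ Finset.range k, x i) / √k| ≤
      2 * B * (n - k : ℝ) / √n := by
  have hB0 : 0 ≤ B := (abs_nonneg _).trans (hB 0)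
  have hkn' : (k : ℝ) ≤ n := by exact_mod_cast hkn
  rcases k.eq_zero_or_pos with rfl | hk
  · have h1 : |∑ i ∈ Finset.range n, x i| ≤ n * B :=
      (Finset.abs_sum_le_sum_abs _ _).trans
        ((Finset.sum_le_sum fun i _ => hB i).trans_eq (by simp))
    simp only [Finset.range_zero, Finset.sum_empty, zero_div, sub_zero, Nat.cast_zero, abs_div,
      abs_of_nonneg (Real.sqrt_nonneg _)]
    gcongr
    nlinarith [mul_nonneg hB0 (Nat.cast_nonneg (α := ℝ) n)]
  have hk' : (0 : ℝ) < √k := Real.sqrt_pos.2 (by exact_mod_cast hk)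
  have hle : √(k : ℝ) ≤ √n := Real.sqrt_le_sqrt hkn'
  have hn' : (0 : ℝ) < √n := hk'.trans_le hle
  have h1 : |∑ i ∈ Finset.range k, x i| ≤ k * B :=
    (Finset.abs_sum_le_sum_abs _ _).trans
      ((Finset.sum_le_sum fun i _ => hB i).trans_eq (by simp))
  have h2 : |∑ i ∈ Finset.Ico k n, x i| ≤ (n - k) * B :=
    (Finset.abs_sum_le_sum_abs _ _).trans
      ((Finset.sum_le_sum fun i _ => hB i).trans_eq (by simp [Nat.cast_sub hkn]))
  rw [← Finset.sum_range_add_sum_Ico _ hkn]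
  set s := ∑ i ∈ Finset.range k, x i
  set r := ∑ i ∈ Finset.Ico k n, x i
  have e : (s + r) / √n - s / √k = (r - s / √k * (√n - √k)) / √n := by
    field_simp
    ring
  rw [e, abs_div, abs_of_pos hn']
  gcongr
  have h3 : |s / √k * (√n - √k)| ≤ (n - k) * B := by
    rw [abs_mul, abs_div, abs_of_pos hk', abs_of_nonneg (sub_nonneg.2 hle)]
    have h4 : |s| / √k ≤ √k * B := by
      rw [div_le_iff₀ hk']
      calc |s| ≤ k * B := h1
        _ = √k * √k * B := by rw [Real.mul_self_sqrt (Nat.cast_nonneg k)]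
        _ = √k * B * √k := by ring
    calc |s| / √k * (√n - √k) ≤ √k * B * (√n - √k) :=
          mul_le_mul_of_nonneg_right h4 (sub_nonneg.2 hle)
      _ ≤ (√n + √k) * B * (√n - √k) := by
          have := sub_nonneg.2 hle
          gcongr
          linarith
      _ = (√n * √n - √k * √k) * B := by ring
      _ = (n - k) * B := by
          rw [Real.mul_self_sqrt (Nat.cast_nonneg k), Real.mul_self_sqrt (Nat.cast_nonneg n)]
  calc |r - s / √k * (√n - √k)| ≤ |r| + |s / √k * (√n - √k)| := abs_sub _ _
    _ ≤ 2 * B * (n - k) := by linarith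

/-- Newman's central limit theorem for bounded Lipschitz functions of a bounded stationary
associated sequence, in terms of characteristic functions. -/
lemma IsAssociated.tendsto_integral_cexp_sum_div_sqrt {μ : Measure Ω} [IsProbabilityMeasure μ]
    {ξ : ℕ → Ω → ℝ} (ha : IsAssociated μ ξ) (hm : ∀ i, Measurable (ξ i)) {C : ℝ}
    (hb : ∀ i ω, |ξ i ω| ≤ C) (hs : ShiftInvariant μ ξ)
    (hnn : ∀ d, 0 ≤ cov μ (ξ 0) (ξ d)) (hsum : Summable fun d => cov μ (ξ 0) (ξ d))
    {φ : ℝ → ℝ} (hφm : Measurable φ) (hφ : ∀ x y, |φ x - φ y| ≤ |x - y|)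
    {B : ℝ} (hφB : ∀ i ω, |φ (ξ i ω)| ≤ B) (hφ0 : ∫ ω, φ (ξ 0 ω) ∂μ = 0)
    (hφsum : Summable fun d => ∫ ω, φ (ξ 0 ω) * φ (ξ (d + 1) ω) ∂μ) {v : ℝ} (hv : 0 < v)
    (hvdef : v = ∫ ω, φ (ξ 0 ω) * φ (ξ 0 ω) ∂μ +
      2 * ∑' d, ∫ ω, φ (ξ 0 ω) * φ (ξ (d + 1) ω) ∂μ) (t : ℝ) :
    Tendsto (fun n : ℕ => ∫ ω, Complex.exp
      ((t * ((∑ i ∈ Finset.range n, φ (ξ i ω)) / √n) : ℝ) * Complex.I) ∂μ) atTop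
      (𝓝 (Complex.exp (-(t ^ 2 * v / 2 : ℝ)))) := by
  have hw := hs.tendsto_integral_sq_div hm hφm hφB hφsum
  rw [← hvdef] at hw
  have hη := (tendsto_cesaro_tsum_tail (c := fun d => cov μ (ξ 0) (ξ d))).const_mul (4 * t ^ 2)
  rw [mul_zero] at hη
  have hexp : Continuous fun w : ℝ => Complex.exp (-(t ^ 2 * w / 2 : ℝ)) := by fun_prop
  have hw' := (hexp.tendsto v).comp hw
  rw [Metric.tendsto_nhds]
  intro ε hε
  obtain ⟨ℓ, hℓ, hℓv, hℓη, hℓw⟩ := ((eventually_gt_atTop 0).and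
    ((hw.eventually (lt_mem_nhds hv)).and ((hη.eventually (gt_mem_nhds (show 0 < ε / 4 by positivity))).and
    (Metric.tendsto_nhds.1 hw' (ε / 4) (by positivity))))).exists
  have hℓ' : (0 : ℝ) < ℓ := by exact_mod_cast hℓ
  set S : ℕ → Ω → ℝ := fun n ω => ∑ i ∈ Finset.range n, φ (ξ i ω) with hSdef
  have hSm : ∀ n, Measurable (S n) := fun n => by fun_prop
  have hSint : ∫ ω, S ℓ ω ∂μ = 0 := by
    have h1 : ∀ i, Integrable (fun ω => φ (ξ i ω)) μ := fun i =>
      (memLp_of_forall_abs_le (hφm.comp (hm i)) (hφB i) 1).integrable le_rfl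
    rw [hSdef, integral_finsetSum _ fun i _ => h1 i]
    exact Finset.sum_eq_zero fun i _ => (hs.integral_comp_eq hm hφm i).trans hφ0
  have hv2 : 0 < ∫ ω, S ℓ ω ^ 2 ∂μ := by
    by_contra! h
    exact absurd hℓv (not_lt.2 (mul_nonpos_of_nonneg_of_nonpos (by positivity) h))
  have hpow := (tendsto_integral_cexp_div_sqrt_pow (hSm ℓ) hSint hv2 hℓ t).comp
    (Nat.tendsto_div_const_atTop hℓ.ne')
  have hδ : Tendsto (fun n : ℕ => |t| * (2 * B * ℓ / √n)) atTop (𝓝 0) := by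
    have h1 : Tendsto (fun n : ℕ => √(n : ℝ)) atTop atTop :=
      Real.tendsto_sqrt_atTop.comp tendsto_natCast_atTop_atTop
    simpa using (h1.const_div_atTop (2 * B * ℓ)).const_mul |t|
  filter_upwards [Metric.tendsto_nhds.1 hpow (ε / 4) (by positivity),
    hδ.eventually (gt_mem_nhds (show 0 < ε / 4 by positivity)), eventually_ge_atTop ℓ]
    with n hn1 hn2 hn3
  simp only [Function.comp_apply] at hn1 hℓw
  set m := n / ℓ with hmdef
  have hm0 : 0 < m := Nat.div_pos hn3 hℓ
  have hm0' : (0 : ℝ) < m := by exact_mod_cast hm0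
  have hmn : m * ℓ ≤ n := Nat.div_mul_le_self n ℓ
  have hB0 : 0 ≤ B := by
    have := nonempty_of_isProbabilityMeasure μ
    exact (abs_nonneg _).trans (hφB 0 Classical.ofNonempty)
  have hclose : ∀ ω, |t * (S n ω / √n) - t / √((m * ℓ : ℕ) : ℝ) * S (m * ℓ) ω| ≤
      |t| * (2 * B * ℓ / √n) := by
    intro ω
    have h1 := abs_sum_div_sqrt_sub_le (x := fun i => φ (ξ i ω)) (fun i => hφB i ω) hmn
    rw [div_mul_eq_mul_div, mul_div_assoc, ← mul_sub, abs_mul]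
    gcongr
    refine h1.trans ?_
    gcongr
    have h2 : n < m * ℓ + ℓ := by
      have := Nat.lt_div_mul_add (a := n) hℓ
      exact this
    have h3 : (n : ℝ) < (m * ℓ : ℕ) + ℓ := by exact_mod_cast h2
    linarith
  have hd1 : ‖∫ ω, Complex.exp ((t * (S n ω / √n) : ℝ) * Complex.I) ∂μ -
      ∫ ω, Complex.exp ((t / √((m * ℓ : ℕ) : ℝ) * S (m * ℓ) ω : ℝ) * Complex.I) ∂μ‖ < ε / 4 := by
    have i1 : Integrable
        (fun ω => |t * (S n ω / √n) - t / √((m * ℓ : ℕ) : ℝ) * S (m * ℓ) ω|) μ :=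
      (memLp_of_forall_abs_le (by fun_prop) (fun ω => (abs_abs _).trans_le (hclose ω))
        1).integrable le_rfl
    refine (norm_integral_cexp_sub_le (f := fun ω => t * (S n ω / √n))
      (g := fun ω => t / √((m * ℓ : ℕ) : ℝ) * S (m * ℓ) ω)
      (by fun_prop) (by fun_prop) i1).trans_lt (lt_of_le_of_lt ?_ hn2)
    refine (integral_mono i1 (integrable_const _) hclose).trans_eq ?_
    simp
  have hd2 := ha.norm_integral_cexp_blocks_sub_pow_le hm hb hs hnn hsum hφm hφ
    (t / √((m * ℓ : ℕ) : ℝ)) ℓ m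
  have e2 : (m : ℝ) * (4 * (t / √((m * ℓ : ℕ) : ℝ)) ^ 2 *
      ∑ k ∈ Finset.range ℓ, ∑' d, cov μ (ξ 0) (ξ (d + (k + 1)))) =
      4 * t ^ 2 * ((ℓ : ℝ)⁻¹ * ∑ k ∈ Finset.range ℓ, ∑' d, cov μ (ξ 0) (ξ (d + (k + 1)))) := by
    rw [div_pow, Real.sq_sqrt (Nat.cast_nonneg _), Nat.cast_mul]
    field_simp
  rw [e2] at hd2
  replace hd2 := hd2.trans_lt hℓη
  rw [← dist_eq_norm] at hd1 hd2
  have tri := dist_triangle4 (∫ ω, Complex.exp ((t * (S n ω / √n) : ℝ) * Complex.I) ∂μ) _ _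
    (Complex.exp (-(t ^ 2 * ((ℓ : ℝ)⁻¹ * ∫ ω, S ℓ ω ^ 2 ∂μ) / 2 : ℝ))) |>.trans_lt
      (add_lt_add (add_lt_add hd1 hd2) hn1)
  refine (dist_triangle _ _ _).trans_lt ((add_lt_add tri hℓw).trans_eq ?_)
  ring

/-- The indicator function of `(-∞, u]`. -/
def stepFun (u x : ℝ) : ℝ := if x ≤ u then 1 else 0

lemma stepFun_nonneg (u x : ℝ) : 0 ≤ stepFun u x := by
  rw [stepFun]; split_ifs <;> norm_num

lemma stepFun_le_one (u x : ℝ) : stepFun u x ≤ 1 := by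
  rw [stepFun]; split_ifs <;> norm_num

lemma abs_stepFun_le_one (u x : ℝ) : |stepFun u x| ≤ 1 :=
  (abs_of_nonneg (stepFun_nonneg u x)).trans_le (stepFun_le_one u x)

@[fun_prop]
lemma Measurable.stepFun {α : Type*} [MeasurableSpace α] {f g : α → ℝ} (hf : Measurable f)
    (hg : Measurable g) : Measurable fun a => stepFun (f a) (g a) :=
  Measurable.ite (measurableSet_le hg hf) measurable_const measurable_const

lemma abs_cov_sub_cov_le {μ : Measure Ω} [IsProbabilityMeasure μ] {f g f' g' : Ω → ℝ}
    (hf : Measurable f) (hg : Measurable g) (hf' : Measurable f') (hg' : Measurable g')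
    (hf1 : ∀ ω, |f ω| ≤ 1) (hg1 : ∀ ω, |g ω| ≤ 1) (hf'1 : ∀ ω, |f' ω| ≤ 1)
    (hg'1 : ∀ ω, |g' ω| ≤ 1) :
    |cov μ f g - cov μ f' g'| ≤ 2 * (∫ ω, |f ω - f' ω| ∂μ + ∫ ω, |g ω - g' ω| ∂μ) := by
  have hL : ∀ {p : Ω → ℝ}, Measurable p → (∀ ω, |p ω| ≤ 1) → MemLp p 2 μ := fun hp h =>
    memLp_of_forall_abs_le hp h 2
  have hI : ∀ {p : Ω → ℝ}, Measurable p → (∀ ω, |p ω| ≤ 1) → Integrable p μ := fun hp h =>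
    (hL hp h).integrable one_le_two
  have iF : Integrable (fun ω => |f ω - f' ω|) μ := ((hI hf hf1).sub (hI hf' hf'1)).abs
  have iG : Integrable (fun ω => |g ω - g' ω|) μ := ((hI hg hg1).sub (hI hg' hg'1)).abs
  have hone : ∀ {p : Ω → ℝ}, (∀ ω, |p ω| ≤ 1) → |∫ ω, p ω ∂μ| ≤ 1 := fun {p} h => by
    have := norm_integral_le_of_norm_le_const (μ := μ)
      (.of_forall fun ω => h ω : ∀ᵐ ω ∂μ, ‖p ω‖ ≤ 1)
    simpa using this
  have h1 : |∫ ω, f ω * g ω ∂μ - ∫ ω, f' ω * g' ω ∂μ| ≤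
      ∫ ω, |f ω - f' ω| ∂μ + ∫ ω, |g ω - g' ω| ∂μ := by
    have j1 : Integrable (fun ω => f ω * g ω) μ := (hL hf hf1).integrable_mul (hL hg hg1)
    have j2 : Integrable (fun ω => f' ω * g' ω) μ := (hL hf' hf'1).integrable_mul (hL hg' hg'1)
    rw [← integral_sub j1 j2, ← integral_add iF iG, ← Real.norm_eq_abs]
    refine norm_integral_le_of_norm_le (iF.add iG) (.of_forall fun ω => ?_)
    rw [Real.norm_eq_abs, show f ω * g ω - f' ω * g' ω =
      (f ω - f' ω) * g ω + f' ω * (g ω - g' ω) by ring]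
    refine (abs_add_le _ _).trans (add_le_add ?_ ?_)
    · rw [abs_mul]
      exact mul_le_of_le_one_right (abs_nonneg _) (hg1 ω)
    · rw [abs_mul]
      exact mul_le_of_le_one_left (abs_nonneg _) (hf'1 ω)
  have h2 : |∫ ω, f ω ∂μ - ∫ ω, f' ω ∂μ| ≤ ∫ ω, |f ω - f' ω| ∂μ := by
    rw [← integral_sub (hI hf hf1) (hI hf' hf'1)]
    exact abs_integral_le_integral_abs
  have h3 : |∫ ω, g ω ∂μ - ∫ ω, g' ω ∂μ| ≤ ∫ ω, |g ω - g' ω| ∂μ := by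
    rw [← integral_sub (hI hg hg1) (hI hg' hg'1)]
    exact abs_integral_le_integral_abs
  have h4 : |(∫ ω, f ω ∂μ) * (∫ ω, g ω ∂μ) - (∫ ω, f' ω ∂μ) * ∫ ω, g' ω ∂μ| ≤
      ∫ ω, |f ω - f' ω| ∂μ + ∫ ω, |g ω - g' ω| ∂μ := by
    rw [show ∀ a b c d : ℝ, a * b - c * d = (a - c) * b + c * (b - d) by intros; ring]
    refine (abs_add_le _ _).trans (add_le_add ?_ ?_)
    · rw [abs_mul]
      exact (mul_le_of_le_one_right (abs_nonneg _) (hone hg1)).trans h2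
    · rw [abs_mul]
      exact (mul_le_of_le_one_left (abs_nonneg _) (hone hf'1)).trans h3
  rw [cov, cov, show ∀ a b c d : ℝ, a - b - (c - d) = (a - c) - (b - d) by intros; ring]
  exact (abs_sub _ _).trans (by linarith)

/-- A Lipschitz approximation of `stepFun u`. -/
lemma exists_lipschitz_approx_stepFun (u : ℝ) {ε : ℝ} (hε : 0 < ε) :
    ∃ g : ℝ → ℝ, Measurable g ∧ (∀ x, |g x| ≤ 1) ∧ (∀ x y, |g x - g y| ≤ ε⁻¹ * |x - y|) ∧
      ∀ x, |stepFun u x - g x| ≤ (Set.Ioc u (u + ε)).indicator 1 x := by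
  refine ⟨fun x => max 0 (min 1 (ε⁻¹ * (u + ε - x))), by fun_prop, fun x => ?_, fun x y => ?_,
    fun x => ?_⟩ <;> dsimp only
  · rw [abs_of_nonneg (le_max_left _ _)]
    exact max_le zero_le_one (min_le_left _ _)
  · have h1 := abs_max_sub_max_le_max 0 (min 1 (ε⁻¹ * (u + ε - x))) 0 (min 1 (ε⁻¹ * (u + ε - y)))
    have h2 := abs_min_sub_min_le_max 1 (ε⁻¹ * (u + ε - x)) 1 (ε⁻¹ * (u + ε - y))
    rw [sub_self, abs_zero] at h1 h2
    refine (h1.trans_eq (max_eq_right (abs_nonneg _))).trans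
      (h2.trans_eq ((max_eq_right (abs_nonneg _)).trans ?_))
    rw [← mul_sub, abs_mul, abs_of_pos (inv_pos.2 hε),
      show u + ε - x - (u + ε - y) = -(x - y) by ring, abs_neg]
  · have hone : ∀ z : ℝ, 0 ≤ (1 : ℝ → ℝ) z := fun z => zero_le_one
    by_cases h1 : x ≤ u
    · have h2 : 1 ≤ ε⁻¹ * (u + ε - x) := by
        rw [inv_mul_eq_div, le_div_iff₀ hε]
        linarith
      rw [stepFun, if_pos h1, min_eq_left h2, max_eq_right zero_le_one, sub_self, abs_zero]
      exact Set.indicator_nonneg (fun z _ => hone z) x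
    · rw [stepFun, if_neg h1, zero_sub, abs_neg, abs_of_nonneg (le_max_left _ _)]
      by_cases h3 : x ≤ u + ε
      · rw [Set.indicator_of_mem (Set.mem_Ioc.2 ⟨not_le.1 h1, h3⟩)]
        exact max_le zero_le_one (min_le_left _ _)
      · rw [Set.indicator_of_notMem fun h => h3 h.2]
        refine max_le le_rfl ((min_le_right _ _).trans ?_)
        exact mul_nonpos_of_nonneg_of_nonpos (by positivity) (by linarith)

/-- The covariances of the indicators of half-lines are controlled by the covariances of the
variables, provided that the marginal laws have a bounded density. -/
lemma IsAssociated.abs_cov_stepFun_le {μ : Measure Ω} [IsProbabilityMeasure μ] {ξ : ℕ → Ω → ℝ}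
    (ha : IsAssociated μ ξ) (hm : ∀ i, Measurable (ξ i)) {C : ℝ} (hb : ∀ i ω, |ξ i ω| ≤ C)
    {M : ℝ} (hM : ∀ i u ε, 0 ≤ ε → ∫ ω, (Set.Ioc u (u + ε)).indicator 1 (ξ i ω) ∂μ ≤ M * ε)
    (u : ℝ) (i j : ℕ) (hc : 0 ≤ cov μ (ξ i) (ξ j)) :
    |cov μ (fun ω => stepFun u (ξ i ω)) (fun ω => stepFun u (ξ j ω))| ≤
      (1 + 4 * M) * cov μ (ξ i) (ξ j) ^ (1 / 3 : ℝ) := by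
  have key : ∀ ε : ℝ, 0 < ε →
      |cov μ (fun ω => stepFun u (ξ i ω)) (fun ω => stepFun u (ξ j ω))| ≤
        ε⁻¹ * ε⁻¹ * cov μ (ξ i) (ξ j) + 4 * M * ε := by
    intro ε hε
    obtain ⟨g, hgm, hg1, hgL, hgs⟩ := exists_lipschitz_approx_stepFun u hε
    have h1 := ha.abs_cov_le hm hb (F := fun x => g (x i)) (G := fun x => g (x j)) (I := {i})
      (J := {j}) (by fun_prop) (by fun_prop) (inv_pos.2 hε).le (inv_pos.2 hε).le
      (fun x y => by simpa using hgL _ _) (fun x y => by simpa using hgL _ _)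
    simp only [Finset.sum_singleton] at h1
    have h2 := abs_cov_sub_cov_le (μ := μ) (f := fun ω => stepFun u (ξ i ω))
      (g := fun ω => stepFun u (ξ j ω)) (f' := fun ω => g (ξ i ω)) (g' := fun ω => g (ξ j ω))
      (by fun_prop) (by fun_prop) (by fun_prop) (by fun_prop)
      (fun ω => abs_stepFun_le_one _ _) (fun ω => abs_stepFun_le_one _ _) (fun ω => hg1 _)
      (fun ω => hg1 _)
    have h3 : ∀ k, ∫ ω, |stepFun u (ξ k ω) - g (ξ k ω)| ∂μ ≤ M * ε := by
      intro k
      refine le_trans (integral_mono_of_nonneg (.of_forall fun ω => abs_nonneg _) ?_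
        (.of_forall fun ω => hgs (ξ k ω))) (hM k u ε hε.le)
      have h4 : Measurable ((Set.Ioc u (u + ε)).indicator (1 : ℝ → ℝ)) :=
        measurable_one.indicator measurableSet_Ioc
      refine (memLp_of_forall_abs_le (K := 1) (h4.comp (hm k)) (fun ω => ?_) 1).integrable le_rfl
      rw [Function.comp_apply, Set.indicator_apply]
      split_ifs <;> simp
    have h5 := abs_sub_abs_le_abs_sub
      (cov μ (fun ω => stepFun u (ξ i ω)) (fun ω => stepFun u (ξ j ω)))
      (cov μ (fun ω => g (ξ i ω)) (fun ω => g (ξ j ω)))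
    have h6 := h3 i
    have h7 := h3 j
    linarith
  rcases hc.eq_or_lt with h0 | h0
  · rw [← h0, Real.zero_rpow (by norm_num), mul_zero]
    rw [← h0] at key
    have h1 : Tendsto (fun ε : ℝ => ε⁻¹ * ε⁻¹ * 0 + 4 * M * ε) (𝓝[>] 0) (𝓝 0) := by
      have : Tendsto (fun ε : ℝ => 4 * M * ε) (𝓝 0) (𝓝 (4 * M * 0)) := by
        exact (continuous_const.mul continuous_id).tendsto 0
      simpa using this.mono_left nhdsWithin_le_nhds
    exact ge_of_tendsto h1 (eventually_mem_nhdsWithin.mono fun ε hε => key ε hε)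
  · refine (key _ (Real.rpow_pos_of_pos h0 (1 / 3))).trans_eq ?_
    set c := cov μ (ξ i) (ξ j)
    set r := c ^ (1 / 3 : ℝ) with hr
    have hr0 : r ≠ 0 := (Real.rpow_pos_of_pos h0 _).ne'
    have h3 : c = r ^ 3 := by
      rw [hr, ← Real.rpow_natCast, ← Real.rpow_mul h0.le]
      norm_num
    rw [h3]
    field_simp

lemma HasBddDensity.exists_integral_indicator_le {μ : Measure Ω} [IsProbabilityMeasure μ]
    {Y : Ω → ℝ} (hY : Measurable Y) (h : HasBddDensity μ Y) :
    ∃ M, 0 ≤ M ∧ ∀ u ε, 0 ≤ ε → ∫ ω, (Set.Ioc u (u + ε)).indicator 1 (Y ω) ∂μ ≤ M * ε := by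
  obtain ⟨d, -, ⟨M, hM⟩, hd0, hd⟩ := h
  have hM0 : 0 ≤ M := (hd0 0).trans (hM 0)
  refine ⟨M, hM0, fun u ε hε => ?_⟩
  have h1 : ∀ ω, (Set.Ioc u (u + ε)).indicator (1 : ℝ → ℝ) (Y ω) =
      (Y ⁻¹' Set.Ioc u (u + ε)).indicator 1 ω := fun ω => rfl
  simp_rw [h1]
  rw [integral_indicator_one (hY measurableSet_Ioc), measureReal_def,
    ← Measure.map_apply hY measurableSet_Ioc, hd]
  refine ENNReal.toReal_le_of_le_ofReal (by positivity) ?_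
  rw [withDensity_apply _ measurableSet_Ioc]
  calc ∫⁻ x in Set.Ioc u (u + ε), ENNReal.ofReal (d x)
      ≤ ∫⁻ _ in Set.Ioc u (u + ε), ENNReal.ofReal M :=
        lintegral_mono fun x => ENNReal.ofReal_le_ofReal (hM x)
    _ = ENNReal.ofReal (M * ε) := by
        rw [setLIntegral_const, Real.volume_Ioc, ← ENNReal.ofReal_mul hM0, add_sub_cancel_left]

lemma sum_range_dist_le {b : ℕ → ℝ} (hb : ∀ d, 0 ≤ b d) (hs : Summable b) {i n : ℕ}
    (hi : i ≤ n) : ∑ j ∈ Finset.range n, b ((i - j) + (j - i)) ≤ 2 * ∑' d, b d := by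
  rw [← Finset.sum_range_add_sum_Ico _ hi, ← Finset.sum_range_reflect, two_mul,
    Finset.sum_Ico_eq_sum_range]
  refine add_le_add ?_ ?_
  · have h1 : ∀ j ∈ Finset.range i, b ((i - (i - 1 - j)) + (i - 1 - j - i)) = b (j + 1) := by
      intro j hj
      rw [Finset.mem_range] at hj
      congr 1
      omega
    rw [Finset.sum_congr rfl h1]
    refine le_trans ?_ (hs.sum_le_tsum (Finset.range (i + 1)) fun d _ => hb d)
    rw [Finset.sum_range_succ']
    linarith [hb 0]
  · have h1 : ∀ j ∈ Finset.range (n - i), b ((i - (i + j)) + (i + j - i)) = b j := by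
      intro j _
      congr 1
      omega
    rw [Finset.sum_congr rfl h1]
    exact hs.sum_le_tsum _ fun d _ => hb d

lemma integrable_Icc_of_abs_le {f : ℝ → ℝ} (hf : Measurable f) {K : ℝ} (hK : ∀ u, |f u| ≤ K)
    (C : ℝ) : Integrable f (volume.restrict (Set.Icc (-C) C)) :=
  (memLp_of_forall_abs_le hf hK 1).integrable le_rfl

lemma integral_stepFun {C x : ℝ} (hx : |x| ≤ C) :
    ∫ u in Set.Icc (-C) C, stepFun u x = C - x := by
  rw [abs_le] at hx
  have h1 : ∀ u, stepFun u x = (Set.Ici x).indicator 1 u := fun u => by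
    simp [stepFun, Set.indicator_apply]
  simp_rw [h1]
  rw [integral_indicator_one measurableSet_Ici, measureReal_restrict_apply measurableSet_Ici]
  have h2 : Set.Ici x ∩ Set.Icc (-C) C = Set.Icc x C := by
    ext u
    simp only [Set.mem_inter_iff, Set.mem_Ici, Set.mem_Icc]
    constructor
    · rintro ⟨h, -, h'⟩
      exact ⟨h, h'⟩
    · rintro ⟨h, h'⟩
      exact ⟨h, hx.1.trans h, h'⟩
  rw [h2, Real.volume_real_Icc_of_le hx.2]

lemma stepFun_mul_stepFun (u x y : ℝ) : stepFun u x * stepFun u y = stepFun u (max x y) := by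
  by_cases h1 : x ≤ u <;> by_cases h2 : y ≤ u <;> simp [stepFun, h1, h2]

lemma abs_sub_eq_integral_stepFun {C x y : ℝ} (hx : |x| ≤ C) (hy : |y| ≤ C) :
    |x - y| = ∫ u in Set.Icc (-C) C,
      (stepFun u x + stepFun u y - 2 * (stepFun u x * stepFun u y)) := by
  have hI : ∀ z, Integrable (fun u => stepFun u z) (volume.restrict (Set.Icc (-C) C)) := fun z =>
    integrable_Icc_of_abs_le (by fun_prop) (fun u => abs_stepFun_le_one u z) C
  have hI2 : Integrable (fun u => stepFun u x + stepFun u y)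
      (volume.restrict (Set.Icc (-C) C)) := (hI x).add (hI y)
  simp_rw [stepFun_mul_stepFun]
  have hmax : |max x y| ≤ C := abs_max_le_max_abs_abs.trans (max_le hx hy)
  rw [integral_sub hI2 ((hI _).const_mul 2), integral_add (hI x) (hI y),
    integral_const_mul, integral_stepFun hx, integral_stepFun hy, integral_stepFun hmax]
  rcases le_total x y with h | h
  · rw [max_eq_right h, abs_sub_comm, abs_of_nonneg (sub_nonneg.2 h)]
    ring
  · rw [max_eq_left h, abs_of_nonneg (sub_nonneg.2 h)]
    ring

lemma integral_integral_Icc_swap {μ : Measure Ω} [IsFiniteMeasure μ] {p : Ω → ℝ → ℝ}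
    (hp : Measurable fun q : Ω × ℝ => p q.1 q.2) {K : ℝ} (hK : ∀ ω u, |p ω u| ≤ K) (C : ℝ) :
    ∫ ω, (∫ u in Set.Icc (-C) C, p ω u) ∂μ = ∫ u in Set.Icc (-C) C, ∫ ω, p ω u ∂μ := by
  refine integral_integral_swap ?_
  exact (memLp_of_forall_abs_le hp (fun q => hK q.1 q.2) 1).integrable le_rfl

/-- The distribution function of `Y`, as an integral. -/
def stepMean (μ : Measure Ω) (Y : Ω → ℝ) (u : ℝ) : ℝ := ∫ ω, stepFun u (Y ω) ∂μ

lemma measurable_stepMean {μ : Measure Ω} [IsFiniteMeasure μ] {Y : Ω → ℝ} (hY : Measurable Y) :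
    Measurable (stepMean μ Y) := by
  have h : StronglyMeasurable fun q : ℝ × Ω => stepFun q.1 (Y q.2) :=
    Measurable.stronglyMeasurable (by fun_prop)
  exact h.integral_prod_right.measurable

lemma abs_stepMean_le_one {μ : Measure Ω} [IsProbabilityMeasure μ] (Y : Ω → ℝ) (u : ℝ) :
    |stepMean μ Y u| ≤ 1 := by
  have := norm_integral_le_of_norm_le_const (μ := μ)
    (.of_forall fun ω => abs_stepFun_le_one u (Y ω) : ∀ᵐ ω ∂μ, ‖stepFun u (Y ω)‖ ≤ 1)
  simpa [stepMean] using this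

lemma integrable_stepFun {μ : Measure Ω} [IsFiniteMeasure μ] {Y : Ω → ℝ} (hY : Measurable Y)
    (u : ℝ) : Integrable (fun ω => stepFun u (Y ω)) μ :=
  (memLp_of_forall_abs_le (by fun_prop) (fun ω => abs_stepFun_le_one u (Y ω)) 1).integrable le_rfl

lemma abs_add_sub_two_mul_le {a b : ℝ} (ha : |a| ≤ 1) (hb : |b| ≤ 1) :
    |a + b - 2 * (a * b)| ≤ 4 := by
  have h1 : |a * b| ≤ 1 := by
    rw [abs_mul]
    exact mul_le_one₀ ha (abs_nonneg _) hb
  rw [abs_le] at *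
  constructor <;> linarith

lemma rho1_eq_integral_stepFun {μ : Measure Ω} [IsProbabilityMeasure μ] {Y : Ω → ℝ}
    (hY : Measurable Y) {C : ℝ} (hC : ∀ ω, |Y ω| ≤ C) {x : ℝ} (hx : |x| ≤ C) :
    rho1 μ Y x = ∫ u in Set.Icc (-C) C,
      (stepFun u x + stepMean μ Y u - 2 * (stepFun u x * stepMean μ Y u)) := by
  rw [rho1, integral_map hY.aemeasurable (by fun_prop)]
  simp_rw [fun ω => abs_sub_eq_integral_stepFun hx (hC ω)]
  rw [integral_integral_Icc_swap (by fun_prop)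
    (fun ω u => abs_add_sub_two_mul_le (abs_stepFun_le_one _ _) (abs_stepFun_le_one _ _))]
  refine integral_congr_ae (.of_forall fun u => ?_)
  have h1 := integrable_stepFun (μ := μ) hY u
  have h2 : Integrable (fun ω => stepFun u x + stepFun u (Y ω)) μ := (integrable_const _).add h1
  simp only
  rw [integral_sub h2 ((h1.const_mul _).const_mul 2), integral_add (integrable_const _) h1,
    integral_const_mul, integral_const_mul]
  simp [stepMean]

lemma measurable_rho1 {μ : Measure Ω} [IsProbabilityMeasure μ] (Y : Ω → ℝ) :
    Measurable (rho1 μ Y) := by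
  have h : StronglyMeasurable fun q : ℝ × ℝ => |q.1 - q.2| :=
    Measurable.stronglyMeasurable (by fun_prop)
  exact h.integral_prod_right.measurable

lemma giniTheta_eq_integral {μ : Measure Ω} [IsProbabilityMeasure μ] {Y : Ω → ℝ}
    (hY : Measurable Y) : giniTheta μ Y = ∫ ω, rho1 μ Y (Y ω) ∂μ :=
  integral_map hY.aemeasurable (measurable_rho1 Y).aestronglyMeasurable

lemma giniTheta_eq_integral_stepMean {μ : Measure Ω} [IsProbabilityMeasure μ] {Y : Ω → ℝ}
    (hY : Measurable Y) {C : ℝ} (hC : ∀ ω, |Y ω| ≤ C) :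
    giniTheta μ Y = ∫ u in Set.Icc (-C) C,
      (stepMean μ Y u + stepMean μ Y u - 2 * (stepMean μ Y u * stepMean μ Y u)) := by
  have hF := measurable_stepMean (μ := μ) hY
  rw [giniTheta_eq_integral hY]
  simp_rw [fun ω => rho1_eq_integral_stepFun (μ := μ) hY hC (hC ω)]
  rw [integral_integral_Icc_swap (by fun_prop)
    (fun ω u => abs_add_sub_two_mul_le (abs_stepFun_le_one _ _) (abs_stepMean_le_one _ _))]
  refine integral_congr_ae (.of_forall fun u => ?_)
  have h1 := integrable_stepFun (μ := μ) hY u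
  have h2 : Integrable (fun ω => stepFun u (Y ω) + stepMean μ Y u) μ :=
    h1.add (integrable_const _)
  simp only
  rw [integral_sub h2 ((h1.mul_const _).const_mul 2), integral_add h1 (integrable_const _),
    integral_const_mul, integral_mul_const]
  simp [stepMean]

lemma h2_eq_integral {μ : Measure Ω} [IsProbabilityMeasure μ] {Y : Ω → ℝ}
    (hY : Measurable Y) {C : ℝ} (hC : ∀ ω, |Y ω| ≤ C) {x y : ℝ} (hx : |x| ≤ C) (hy : |y| ≤ C) :
    h2 μ Y x y = -2 * ∫ u in Set.Icc (-C) C,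
      (stepFun u x - stepMean μ Y u) * (stepFun u y - stepMean μ Y u) := by
  have hF := measurable_stepMean (μ := μ) hY
  rw [h2, abs_sub_eq_integral_stepFun hx hy, rho1_eq_integral_stepFun hY hC hx,
    rho1_eq_integral_stepFun hY hC hy, giniTheta_eq_integral_stepMean hY hC]
  have i1 : Integrable (fun u => stepFun u x + stepFun u y - 2 * (stepFun u x * stepFun u y))
      (volume.restrict (Set.Icc (-C) C)) := integrable_Icc_of_abs_le (by fun_prop)
    (fun u => abs_add_sub_two_mul_le (abs_stepFun_le_one _ _) (abs_stepFun_le_one _ _)) C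
  have i2 : ∀ z, Integrable
      (fun u => stepFun u z + stepMean μ Y u - 2 * (stepFun u z * stepMean μ Y u))
      (volume.restrict (Set.Icc (-C) C)) := fun z => integrable_Icc_of_abs_le (by fun_prop)
    (fun u => abs_add_sub_two_mul_le (abs_stepFun_le_one _ _) (abs_stepMean_le_one _ _)) C
  have i3 : Integrable
      (fun u => stepMean μ Y u + stepMean μ Y u - 2 * (stepMean μ Y u * stepMean μ Y u))
      (volume.restrict (Set.Icc (-C) C)) := integrable_Icc_of_abs_le (by fun_prop)
    (fun u => abs_add_sub_two_mul_le (abs_stepMean_le_one _ _) (abs_stepMean_le_one _ _)) C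
  have lin : ∀ {a b c d : ℝ → ℝ} {ν : Measure ℝ}, Integrable a ν → Integrable b ν →
      Integrable c ν → Integrable d ν →
      ∫ u, a u ∂ν - ∫ u, b u ∂ν - ∫ u, c u ∂ν + ∫ u, d u ∂ν = ∫ u, (a u - b u - c u + d u) ∂ν := by
    intro a b c d ν ha hb hc hd
    have j1 : Integrable (fun u => a u - b u) ν := ha.sub hb
    have j2 : Integrable (fun u => a u - b u - c u) ν := j1.sub hc
    rw [integral_add j2 hd, integral_sub j1 hc, integral_sub ha hb]
  rw [lin i1 (i2 x) (i2 y) i3, ← integral_const_mul]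
  refine integral_congr_ae (.of_forall fun u => ?_)
  simp only
  ring

/-- The degenerate part of the Gini statistic is, up to sign, an integral of squares. -/
lemma sum_h2_eq {μ : Measure Ω} [IsProbabilityMeasure μ] {Y : Ω → ℝ}
    (hY : Measurable Y) {C : ℝ} (hC : ∀ ω, |Y ω| ≤ C) {x : ℕ → ℝ} (hx : ∀ i, |x i| ≤ C) (n : ℕ) :
    ∑ i ∈ Finset.range n, ∑ j ∈ Finset.range n, h2 μ Y (x i) (x j) =
      -2 * ∫ u in Set.Icc (-C) C,
        (∑ i ∈ Finset.range n, (stepFun u (x i) - stepMean μ Y u)) ^ 2 := by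
  have hF := measurable_stepMean (μ := μ) hY
  have h1 : ∀ z u, |stepFun u z - stepMean μ Y u| ≤ 2 := fun z u =>
    (abs_sub _ _).trans (by linarith [abs_stepFun_le_one u z, abs_stepMean_le_one (μ := μ) Y u])
  have i1 : ∀ i j, Integrable
      (fun u => (stepFun u (x i) - stepMean μ Y u) * (stepFun u (x j) - stepMean μ Y u))
      (volume.restrict (Set.Icc (-C) C)) := fun i j =>
    integrable_Icc_of_abs_le (K := 2 * 2) (by fun_prop) (fun u => by
      rw [abs_mul]
      exact mul_le_mul (h1 _ _) (h1 _ _) (abs_nonneg _) zero_le_two) C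
  simp_rw [fun i j => h2_eq_integral (μ := μ) hY hC (hx i) (hx j), sq, Finset.sum_mul_sum]
  rw [integral_finsetSum _ fun i _ => integrable_finsetSum _ fun j _ => i1 i j]
  simp_rw [fun i => integral_finsetSum (Finset.range n) fun j _ => i1 i j, Finset.mul_sum]

/-- The expectation of the degenerate part of the Gini statistic grows at most linearly. -/
lemma IsAssociated.integral_integral_sq_le {μ : Measure Ω} [IsProbabilityMeasure μ]
    {ξ : ℕ → Ω → ℝ} (ha : IsAssociated μ ξ) (hm : ∀ i, Measurable (ξ i)) {C : ℝ}
    (hb : ∀ i ω, |ξ i ω| ≤ C) (hs : ShiftInvariant μ ξ) {M : ℝ} (hM0 : 0 ≤ M)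
    (hM : ∀ i u ε, 0 ≤ ε → ∫ ω, (Set.Ioc u (u + ε)).indicator 1 (ξ i ω) ∂μ ≤ M * ε)
    (hnn : ∀ d, 0 ≤ cov μ (ξ 0) (ξ d))
    (hsum : Summable fun d => cov μ (ξ 0) (ξ d) ^ (1 / 3 : ℝ)) (n : ℕ) :
    ∫ ω, (∫ u in Set.Icc (-C) C,
      (∑ i ∈ Finset.range n, (stepFun u (ξ i ω) - stepMean μ (ξ 0) u)) ^ 2) ∂μ ≤
      2 * C * ((1 + 4 * M) * (n * (2 * ∑' d, cov μ (ξ 0) (ξ d) ^ (1 / 3 : ℝ)))) := by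
  have hC : 0 ≤ C := by
    have := nonempty_of_isProbabilityMeasure μ
    exact (abs_nonneg _).trans (hb 0 Classical.ofNonempty)
  have hF := measurable_stepMean (μ := μ) (hm 0)
  have h1 : ∀ z u, |stepFun u z - stepMean μ (ξ 0) u| ≤ 2 := fun z u =>
    (abs_sub _ _).trans (by linarith [abs_stepFun_le_one u z, abs_stepMean_le_one (μ := μ) (ξ 0) u])
  have h2 : ∀ ω u, |(∑ i ∈ Finset.range n, (stepFun u (ξ i ω) - stepMean μ (ξ 0) u)) ^ 2| ≤
      (n * 2) ^ 2 := by
    intro ω u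
    rw [abs_pow]
    gcongr
    exact (Finset.abs_sum_le_sum_abs _ _).trans
      ((Finset.sum_le_sum fun i _ => h1 _ _).trans_eq (by simp))
  rw [integral_integral_Icc_swap (by fun_prop) h2]
  have hcov : ∀ i j, cov μ (ξ i) (ξ j) = cov μ (ξ 0) (ξ ((i - j) + (j - i))) := by
    intro i j
    rcases le_total i j with h | h
    · rw [← hs.cov_eq hm i, show i + (i - j + (j - i)) = j by omega]
    · rw [← hs.cov_eq hm j, show j + (i - j + (j - i)) = i by omega]
      simp only [cov, mul_comm]
  have key : ∀ u, ∫ ω, (∑ i ∈ Finset.range n, (stepFun u (ξ i ω) - stepMean μ (ξ 0) u)) ^ 2 ∂μ ≤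
      (1 + 4 * M) * (n * (2 * ∑' d, cov μ (ξ 0) (ξ d) ^ (1 / 3 : ℝ))) := by
    intro u
    have hmean : ∀ i, ∫ ω, stepFun u (ξ i ω) ∂μ = stepMean μ (ξ 0) u := fun i =>
      hs.integral_comp_eq hm (f := fun x => stepFun u x) (by fun_prop) i
    have i0 : ∀ i, Integrable (fun ω => stepFun u (ξ i ω)) μ := fun i => integrable_stepFun (hm i) u
    have i1 : ∀ i j, Integrable (fun ω => stepFun u (ξ i ω) * stepFun u (ξ j ω)) μ := fun i j => by
      simp_rw [stepFun_mul_stepFun]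
      exact integrable_stepFun ((hm i).max (hm j)) u
    have i2 : ∀ i j, Integrable (fun ω =>
        (stepFun u (ξ i ω) - stepMean μ (ξ 0) u) * (stepFun u (ξ j ω) - stepMean μ (ξ 0) u)) μ :=
      fun i j => (memLp_of_forall_abs_le (K := 2 * 2) (by fun_prop) (fun ω => by
        rw [abs_mul]
        exact mul_le_mul (h1 _ _) (h1 _ _) (abs_nonneg _) zero_le_two) 1).integrable le_rfl
    have e1 : ∀ i j, ∫ ω, (stepFun u (ξ i ω) - stepMean μ (ξ 0) u) *
        (stepFun u (ξ j ω) - stepMean μ (ξ 0) u) ∂μ =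
        cov μ (fun ω => stepFun u (ξ i ω)) (fun ω => stepFun u (ξ j ω)) := by
      intro i j
      set F := stepMean μ (ξ 0) u
      have e2 : ∀ ω, (stepFun u (ξ i ω) - F) * (stepFun u (ξ j ω) - F) =
          stepFun u (ξ i ω) * stepFun u (ξ j ω) - F * (stepFun u (ξ i ω) + stepFun u (ξ j ω) - F) :=
        fun ω => by ring
      simp_rw [e2]
      have i3 : Integrable (fun ω => stepFun u (ξ i ω) + stepFun u (ξ j ω)) μ := (i0 i).add (i0 j)
      have i4 : Integrable (fun ω => stepFun u (ξ i ω) + stepFun u (ξ j ω) - F) μ :=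
        i3.sub (integrable_const _)
      rw [integral_sub (i1 i j) (i4.const_mul F), integral_const_mul,
        integral_sub i3 (integrable_const _), integral_add (i0 i) (i0 j), cov, hmean, hmean]
      simp
    simp_rw [sq, Finset.sum_mul_sum]
    rw [integral_finsetSum _ fun i _ => integrable_finsetSum _ fun j _ => i2 i j]
    simp_rw [fun i => integral_finsetSum (Finset.range n) fun j _ => i2 i j, e1]
    have e3 : ∀ i j, cov μ (fun ω => stepFun u (ξ i ω)) (fun ω => stepFun u (ξ j ω)) ≤
        (1 + 4 * M) * cov μ (ξ 0) (ξ ((i - j) + (j - i))) ^ (1 / 3 : ℝ) := by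
      intro i j
      rw [← hcov i j]
      exact (le_abs_self _).trans (ha.abs_cov_stepFun_le hm hb hM u i j
        ((hcov i j).symm ▸ hnn _))
    refine (Finset.sum_le_sum fun i _ => Finset.sum_le_sum fun j _ => e3 i j).trans ?_
    simp_rw [← Finset.mul_sum]
    gcongr
    refine (Finset.sum_le_sum fun i hi => sum_range_dist_le
      (b := fun d => cov μ (ξ 0) (ξ d) ^ (1 / 3 : ℝ)) (fun d => Real.rpow_nonneg (hnn d) _) hsum
      (Finset.mem_range.1 hi).le).trans_eq ?_
    simp
  refine (integral_mono_of_nonneg (.of_forall fun u => integral_nonneg fun ω => sq_nonneg _)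
    (integrable_const _) (.of_forall key)).trans_eq ?_
  rw [integral_const, smul_eq_mul, measureReal_restrict_apply MeasurableSet.univ, Set.univ_inter,
    Real.volume_real_Icc_of_le (by linarith)]
  ring

/-- Lévy's continuity theorem for the standard normal limit. -/
lemma tendstoStdGaussian_of_tendsto_integral_cexp {μ : Measure Ω} [IsProbabilityMeasure μ]
    {Z : ℕ → Ω → ℝ} (hZ : ∀ n, Measurable (Z n))
    (h : ∀ t : ℝ, Tendsto (fun n => ∫ ω, Complex.exp ((t * Z n ω : ℝ) * Complex.I) ∂μ) atTop
      (𝓝 (Complex.exp (-(t ^ 2 / 2 : ℝ))))) :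
    TendstoStdGaussian μ Z := by
  let P : ℕ → ProbabilityMeasure ℝ := fun n =>
    ⟨μ.map (Z n), Measure.isProbabilityMeasure_map (hZ n).aemeasurable⟩
  let G : ProbabilityMeasure ℝ := ⟨gaussianReal 0 1, inferInstance⟩
  have hP : Tendsto P atTop (𝓝 G) := by
    rw [ProbabilityMeasure.tendsto_iff_tendsto_charFun]
    intro t
    have e1 : charFun (G : Measure ℝ) t = Complex.exp (-(t ^ 2 / 2 : ℝ)) := by
      change charFun (gaussianReal 0 1) t = _
      rw [charFun_gaussianReal]
      congr 1
      push_cast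
      ring
    rw [e1]
    refine (h t).congr fun n => ?_
    change _ = charFun (μ.map (Z n)) t
    rw [charFun_apply_real, integral_map (hZ n).aemeasurable (by fun_prop)]
    simp_rw [Complex.ofReal_mul]
  intro f
  refine (ProbabilityMeasure.tendsto_iff_forall_integral_tendsto.1 hP f).congr fun n => ?_
  exact integral_map (hZ n).aemeasurable f.continuous.aestronglyMeasurable

lemma IsAssociated.comp_succ {μ : Measure Ω} {X : ℕ → Ω → ℝ} (ha : IsAssociated μ X) :
    IsAssociated μ fun i => X (i + 1) := by
  intro S h g hh hg hhm hgm
  let e : (S.map (addRightEmbedding 1) → ℝ) → S → ℝ := fun x i =>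
    x ⟨i + 1, Finset.mem_map_of_mem _ i.2⟩
  have he : Monotone e := fun x y hxy i => hxy _
  have hem : Measurable e := measurable_pi_lambda _ fun i => measurable_pi_apply _
  exact ha (S.map (addRightEmbedding 1)) (h ∘ e) (g ∘ e) (hh.comp he) (hg.comp he)
    (hhm.comp hem) (hgm.comp hem)

lemma StrictStationary.shiftInvariant {μ : Measure Ω} {X : ℕ → Ω → ℝ}
    (hs : StrictStationary μ X) : ShiftInvariant μ fun i => X (i + 1) := by
  intro k n
  have h := hs k n
  simp only [add_comm 1, add_right_comm _ 1 k] at h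
  exact h

lemma summable_rpow_of_le {c : ℕ → ℝ} (hc : ∀ d, 0 ≤ c d) {p q : ℝ} (hp : 0 < p) (hpq : p ≤ q)
    (h : Summable fun d => c d ^ p) : Summable fun d => c d ^ q := by
  refine .of_norm_bounded_eventually_nat h ?_
  filter_upwards [h.tendsto_atTop_zero.eventually (gt_mem_nhds zero_lt_one)] with d hd
  have h1 : c d ≤ 1 := by
    by_contra! h1
    exact absurd (Real.one_lt_rpow h1 hp) (not_lt.2 hd.le)
  rw [Real.norm_eq_abs, abs_of_nonneg (Real.rpow_nonneg (hc d) _)]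
  exact Real.rpow_le_rpow_of_exponent_ge' (hc d) h1 hp.le hpq

lemma abs_rho1_sub_le {μ : Measure Ω} [IsProbabilityMeasure μ] {Y : Ω → ℝ} (hY : Measurable Y)
    {C : ℝ} (hC : ∀ ω, |Y ω| ≤ C) (x y : ℝ) : |rho1 μ Y x - rho1 μ Y y| ≤ |x - y| := by
  have hI : ∀ z, Integrable (fun ω => |z - Y ω|) μ := fun z =>
    (memLp_of_forall_abs_le (K := |z| + C) (by fun_prop) (fun ω => by
      rw [abs_abs]
      exact (abs_sub _ _).trans (by linarith [hC ω])) 1).integrable le_rfl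
  rw [rho1, rho1, integral_map hY.aemeasurable (by fun_prop),
    integral_map hY.aemeasurable (by fun_prop), ← integral_sub (hI x) (hI y)]
  have h1 : ∀ ω, ‖|x - Y ω| - |y - Y ω|‖ ≤ |x - y| := fun ω => by
    have := abs_abs_sub_abs_le_abs_sub (x - Y ω) (y - Y ω)
    rwa [sub_sub_sub_cancel_right] at this
  have := norm_integral_le_of_norm_le_const (μ := μ) (.of_forall h1)
  simpa using this

lemma two_mul_sum_Icc_abs_sub (x : ℕ → ℝ) (n : ℕ) :
    2 * ∑ i ∈ Finset.Icc 1 n, ∑ j ∈ Finset.Icc (i + 1) n, |x i - x j| =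
      ∑ i ∈ Finset.range n, ∑ j ∈ Finset.range n, |x (i + 1) - x (j + 1)| := by
  have hshift : ∀ (f : ℕ → ℝ) (N : ℕ),
      ∑ i ∈ Finset.Icc 1 N, f i = ∑ i ∈ Finset.range N, f (i + 1) := by
    intro f N
    induction N with
    | zero => simp
    | succ N ih => rw [Finset.sum_Icc_succ_top (by omega), ih, Finset.sum_range_succ]
  induction n with
  | zero => simp
  | succ N ih =>
    have h1 : ∀ i ∈ Finset.Icc 1 N, ∑ j ∈ Finset.Icc (i + 1) (N + 1), |x i - x j| =
        ∑ j ∈ Finset.Icc (i + 1) N, |x i - x j| + |x i - x (N + 1)| := by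
      intro i hi
      rw [Finset.mem_Icc] at hi
      rw [Finset.sum_Icc_succ_top (by omega)]
    rw [Finset.sum_Icc_succ_top (by omega), Finset.sum_congr rfl h1, Finset.sum_add_distrib,
      Finset.Icc_eq_empty (a := N + 1 + 1) (by omega), Finset.sum_empty, add_zero, mul_add, ih,
      hshift]
    simp_rw [Finset.sum_range_succ, Finset.sum_add_distrib, abs_sub_comm (x (N + 1)), sub_self,
      abs_zero]
    ring

/-- The Hoeffding decomposition of the Gini statistic. -/
lemma giniU_eq {μ : Measure Ω} {X : ℕ → Ω → ℝ} (n : ℕ) (ω : Ω) :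
    giniU X n ω = (∑ i ∈ Finset.range n, ∑ j ∈ Finset.range n,
      h2 μ (X 1) (X (i + 1) ω) (X (j + 1) ω) +
      2 * n * (∑ i ∈ Finset.range n, (rho1 μ (X 1) (X (i + 1) ω) - giniTheta μ (X 1))) +
      n ^ 2 * giniTheta μ (X 1)) / (n * (n - 1)) := by
  rw [giniU, div_mul_eq_mul_div, two_mul_sum_Icc_abs_sub (fun i => X i ω)]
  congr 1
  have h1 : ∀ x y, |x - y| = h2 μ (X 1) x y + (rho1 μ (X 1) x - giniTheta μ (X 1)) +
      (rho1 μ (X 1) y - giniTheta μ (X 1)) + giniTheta μ (X 1) := fun x y => by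
    rw [h2]
    ring
  simp_rw [h1, Finset.sum_add_distrib, Finset.sum_const, Finset.card_range, nsmul_eq_mul,
    ← Finset.mul_sum]
  ring

/-- The normalized Gini statistic is close to the normalized sum of its projections. -/
lemma abs_giniU_sub_le {μ : Measure Ω} [IsProbabilityMeasure μ] {X : ℕ → Ω → ℝ}
    (hm : Measurable (X 1)) {C : ℝ} (hb : ∀ i ω, |X (i + 1) ω| ≤ C) {B : ℝ}
    (hB : ∀ i ω, |rho1 μ (X 1) (X (i + 1) ω) - giniTheta μ (X 1)| ≤ B)
    {σ : ℝ} (hσ : 0 < σ) {n : ℕ} (hn : 2 ≤ n) (ω : Ω) :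
    |√(n : ℝ) * (giniU X n ω - giniTheta μ (X 1)) / (2 * σ) -
      σ⁻¹ * ((∑ i ∈ Finset.range n, (rho1 μ (X 1) (X (i + 1) ω) - giniTheta μ (X 1))) / √n)| ≤
      2 / (σ * √n) * ((∫ u in Set.Icc (-C) C, (∑ i ∈ Finset.range n,
        (stepFun u (X (i + 1) ω) - stepMean μ (X 1) u)) ^ 2) / n + |giniTheta μ (X 1)| + B) := by
  rw [giniU_eq (μ := μ), sum_h2_eq hm (hb 0) (fun i => hb i ω)]
  set Q := ∫ u in Set.Icc (-C) C, (∑ i ∈ Finset.range n,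
        (stepFun u (X (i + 1) ω) - stepMean μ (X 1) u)) ^ 2
  have hQ : 0 ≤ Q := integral_nonneg fun u => sq_nonneg _
  set θ := giniTheta μ (X 1)
  set S := ∑ i ∈ Finset.range n, (rho1 μ (X 1) (X (i + 1) ω) - θ) with hS
  have hn2 : (2 : ℝ) ≤ n := by exact_mod_cast hn
  have hn0 : (0 : ℝ) < n := by linarith
  have hn1 : (0 : ℝ) < n - 1 := by linarith
  have hSb : |S| ≤ n * B :=
    (Finset.abs_sum_le_sum_abs _ _).trans ((Finset.sum_le_sum fun i _ => hB i ω).trans_eq (by simp))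
  set r := √(n : ℝ)
  have hr : 0 < r := Real.sqrt_pos.2 hn0
  have hrn : (n : ℝ) = r ^ 2 := (Real.sq_sqrt hn0.le).symm
  have e1 : r * ((-2 * Q + 2 * n * S + n ^ 2 * θ) / (n * (n - 1)) - θ) / (2 * σ) -
      σ⁻¹ * (S / r) = (r ^ 2 / (n - 1)) / (σ * r) * (-(Q / n) + θ / 2 + S / n) := by
    have h1 : (n : ℝ) - 1 ≠ 0 := hn1.ne'
    rw [hrn] at h1 ⊢
    field_simp
    ring
  rw [e1, abs_mul]
  have h2 : |r ^ 2 / (n - 1) / (σ * r)| ≤ 2 / (σ * r) := by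
    rw [abs_of_pos (by positivity)]
    gcongr
    rw [div_le_iff₀ hn1, ← hrn]
    linarith
  have h3 : |-(Q / n) + θ / 2 + S / n| ≤ Q / n + |θ| + B := by
    have h4 : |S / n| ≤ B := by
      rw [abs_div, abs_of_pos hn0, div_le_iff₀ hn0]
      linarith
    have h5 : 0 ≤ Q / n := by positivity
    have h6 := abs_le.1 h4
    have h7 := neg_abs_le θ
    have h8 := le_abs_self θ
    have h9 := abs_nonneg θ
    rw [abs_le]
    constructor <;> linarith
  exact mul_le_mul h2 h3 (abs_nonneg _) (by positivity)

/-- **Theorem 4.1** (CLT for Gini's mean difference): for a bounded stationary associated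
sequence whose marginal has a bounded density, if `∑_{j=1}^∞ Cov(X₁,Xⱼ)^γ < ∞` for some
`0 < γ < 1/6` and `σ_U² > 0`, then `√n (U_n − θ)/(2σ_U) → N(0,1)` in distribution, where
`σ_U² = Var(ρ₁(X₁)) + 2 ∑_{j=1}^∞ Cov(ρ₁(X₁), ρ₁(X_{1+j}))`. -/
theorem gini_clt (μ : Measure Ω) [IsProbabilityMeasure μ]
    (X : ℕ → Ω → ℝ) (hmeas : ∀ j, Measurable (X j))
    (hstat : StrictStationary μ X) (hassoc : IsAssociated μ X)
    (C₁ : ℝ) (hbdd : ∀ n : ℕ, 1 ≤ n → ∀ ω, |X n ω| ≤ C₁)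
    (hdens : HasBddDensity μ (X 1))
    (γ : ℝ) (hγ0 : 0 < γ) (hγ : γ < 1 / 6)
    (hsumγ : Summable fun j : ℕ => cov μ (X 1) (X (j + 1)) ^ γ)
    (σU2 : ℝ)
    (hσU2 : σU2 = cov μ (fun ω => rho1 μ (X 1) (X 1 ω)) (fun ω => rho1 μ (X 1) (X 1 ω)) +
      2 * ∑' j : ℕ,
        cov μ (fun ω => rho1 μ (X 1) (X 1 ω)) (fun ω => rho1 μ (X 1) (X (j + 2) ω)))
    (hσUpos : 0 < σU2) :
    TendstoStdGaussian μ fun n ω =>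
      Real.sqrt (n : ℝ) * (giniU X n ω - giniTheta μ (X 1)) / (2 * Real.sqrt σU2) := by
  have hm : ∀ i, Measurable (X (i + 1)) := fun i => hmeas _
  have hb : ∀ i ω, |X (i + 1) ω| ≤ C₁ := fun i => hbdd _ (Nat.le_add_left 1 i)
  have ha := hassoc.comp_succ
  have hs := hstat.shiftInvariant
  have hcL : ∀ d, |cov μ (fun ω => rho1 μ (X 1) (X 1 ω)) (fun ω => rho1 μ (X 1) (X (d + 1) ω))| ≤
      cov μ (X 1) (X (d + 1)) := fun d => by
    simpa using ha.abs_cov_le hm hb (F := fun x => rho1 μ (X 1) (x 0))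
      (G := fun x => rho1 μ (X 1) (x d)) (I := {0}) (J := {d}) (L := 1) (K := 1)
      ((measurable_rho1 _).comp (measurable_pi_apply _))
      ((measurable_rho1 _).comp (measurable_pi_apply _)) zero_le_one zero_le_one
      (fun x y => by simpa using abs_rho1_sub_le (hm 0) (hb 0) (x 0) (y 0))
      (fun x y => by simpa using abs_rho1_sub_le (hm 0) (hb 0) (x d) (y d))
  have hnn : ∀ d, 0 ≤ cov μ (X 1) (X (d + 1)) := fun d => (abs_nonneg _).trans (hcL d)
  have hsum1 : Summable fun d => cov μ (X 1) (X (d + 1)) := by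
    simpa using summable_rpow_of_le hnn hγ0 (q := 1) (by linarith) hsumγ
  have hsum3 : Summable fun d => cov μ (X 1) (X (d + 1)) ^ (1 / 3 : ℝ) :=
    summable_rpow_of_le hnn hγ0 (by linarith) hsumγ
  obtain ⟨M, hM0, hM⟩ := hdens.exists_integral_indicator_le (hm 0)
  have hM' : ∀ i u ε, 0 ≤ ε →
      ∫ ω, (Set.Ioc u (u + ε)).indicator 1 (X (i + 1) ω) ∂μ ≤ M * ε := fun i u ε hε =>
    (hs.integral_comp_eq hm (f := (Set.Ioc u (u + ε)).indicator 1)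
      (measurable_one.indicator measurableSet_Ioc) i).trans_le (hM u ε hε)
  have hρm := measurable_rho1 (μ := μ) (X 1)
  set θ := giniTheta μ (X 1) with hθ
  let φ : ℝ → ℝ := fun x => rho1 μ (X 1) x - θ
  have hφm : Measurable φ := hρm.sub_const θ
  have hφL : ∀ x y, |φ x - φ y| ≤ |x - y| := fun x y => by
    simpa [φ] using abs_rho1_sub_le (μ := μ) (hm 0) (hb 0) x y
  have hφB : ∀ i ω, |φ (X (i + 1) ω)| ≤ |φ 0| + C₁ := fun i ω => by
    have h1 := hφL (X (i + 1) ω) 0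
    have h2 := abs_sub_abs_le_abs_sub (φ (X (i + 1) ω)) (φ 0)
    rw [sub_zero] at h1
    linarith [hb i ω]
  have hρint : ∀ i, MemLp (fun ω => rho1 μ (X 1) (X (i + 1) ω)) 2 μ := fun i =>
    memLp_of_forall_abs_le (K := |φ 0| + C₁ + |θ|) (hρm.comp (hm i)) (fun ω => by
      have h1 := abs_add_le (φ (X (i + 1) ω)) θ
      rw [sub_add_cancel] at h1
      rw [Function.comp_apply]
      linarith [hφB i ω]) 2
  have hρmean : ∀ i, ∫ ω, rho1 μ (X 1) (X (i + 1) ω) ∂μ = θ := fun i =>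
    (hs.integral_comp_eq hm hρm i).trans (giniTheta_eq_integral (hm 0)).symm
  have hφ0 : ∫ ω, φ (X 1 ω) ∂μ = 0 := by
    have h1 := integral_sub ((hρint 0).integrable one_le_two) (integrable_const θ)
    rw [hρmean 0] at h1
    simpa [φ] using h1
  have hφcov : ∀ d, ∫ ω, φ (X 1 ω) * φ (X (d + 1) ω) ∂μ =
      cov μ (fun ω => rho1 μ (X 1) (X 1 ω)) (fun ω => rho1 μ (X 1) (X (d + 1) ω)) := fun d => by
    rw [cov_eq_covariance (hρint 0) (hρint d), covariance, hρmean d]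
    have h1 := hρmean 0
    rw [zero_add] at h1
    rw [h1]
  have hφsum : Summable fun d => ∫ ω, φ (X 1 ω) * φ (X (d + 1 + 1) ω) ∂μ := by
    simp_rw [fun d => hφcov (d + 1)]
    exact .of_norm_bounded ((summable_nat_add_iff 1).2 hsum1) fun d => hcL (d + 1)
  set σ := √σU2 with hσdef
  have hσ : 0 < σ := Real.sqrt_pos.2 hσUpos
  have hσ2 : σ ^ 2 = σU2 := Real.sq_sqrt hσUpos.le
  have hclt := fun t => ha.tendsto_integral_cexp_sum_div_sqrt hm hb hs hnn hsum1 hφm hφL hφB hφ0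
    hφsum hσUpos (by
      rw [hσU2, hφcov 0]
      simp_rw [fun d => hφcov (d + 1)]) t
  set K := 2 * C₁ * ((1 + 4 * M) * (2 * ∑' d, cov μ (X 1) (X (d + 1)) ^ (1 / 3 : ℝ)))
  set W : ℕ → Ω → ℝ := fun n ω => σ⁻¹ * ((∑ i ∈ Finset.range n, φ (X (i + 1) ω)) / √n)
  set Z : ℕ → Ω → ℝ := fun n ω => √(n : ℝ) * (giniU X n ω - θ) / (2 * σ)
  have hWm : ∀ n, Measurable (W n) := fun n => by
    have := fun i => hφm.comp (hm i)
    exact ((Finset.measurable_fun_sum _ fun i _ => this i).div_const _).const_mul _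
  have hZm : ∀ n, Measurable (Z n) := fun n => by
    have : Measurable (giniU X n) := by
      unfold giniU
      fun_prop
    fun_prop
  have hZW : ∀ n : ℕ, 2 ≤ n → Integrable (fun ω => |Z n ω - W n ω|) μ ∧
      ∫ ω, |Z n ω - W n ω| ∂μ ≤ 2 / (σ * √n) * (K + |θ| + (|φ 0| + C₁)) := by
    intro n hn
    have hn0 : (0 : ℝ) < n := by exact_mod_cast (by omega : 0 < n)
    let Q : Ω → ℝ := fun ω => ∫ u in Set.Icc (-C₁) C₁, (∑ i ∈ Finset.range n,
        (stepFun u (X (i + 1) ω) - stepMean μ (X 1) u)) ^ 2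
    have hF := measurable_stepMean (μ := μ) (hm 0)
    have hQint : Integrable Q μ := by
      have h1 : Integrable (fun q : Ω × ℝ => (∑ i ∈ Finset.range n,
          (stepFun q.2 (X (i + 1) q.1) - stepMean μ (X 1) q.2)) ^ 2)
          (μ.prod (volume.restrict (Set.Icc (-C₁) C₁))) := by
        refine (memLp_of_forall_abs_le (K := (n * 2) ^ 2) (by fun_prop) (fun q => ?_) 1).integrable
          le_rfl
        rw [abs_pow]
        gcongr
        refine (Finset.abs_sum_le_sum_abs _ _).trans
          ((Finset.sum_le_sum fun i _ => (abs_sub _ _).trans (add_le_add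
            (abs_stepFun_le_one _ _) (abs_stepMean_le_one _ _))).trans_eq ?_)
        simp [one_add_one_eq_two]
      exact h1.integral_prod_left
    have hQle : ∫ ω, Q ω ∂μ ≤ n * K :=
      (ha.integral_integral_sq_le hm hb hs hM0 hM' hnn hsum3 n).trans_eq (by ring)
    have hpt : ∀ ω, |Z n ω - W n ω| ≤ 2 / (σ * √n) * (Q ω / n + |θ| + (|φ 0| + C₁)) := fun ω =>
      abs_giniU_sub_le (hm 0) hb hφB hσ hn ω
    have i1 : Integrable (fun ω => Q ω / n + |θ|) μ := (hQint.div_const _).add (integrable_const _)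
    have i2 : Integrable (fun ω => 2 / (σ * √n) * (Q ω / n + |θ| + (|φ 0| + C₁))) μ :=
      (i1.add (integrable_const _)).const_mul _
    have i3 : Integrable (fun ω => |Z n ω - W n ω|) μ :=
      i2.mono' (((hZm n).sub (hWm n)).abs.aestronglyMeasurable)
        (.of_forall fun ω => (abs_abs _).trans_le (hpt ω))
    refine ⟨i3, (integral_mono i3 i2 hpt).trans ?_⟩
    rw [integral_const_mul, integral_add i1 (integrable_const _),
      integral_add (hQint.div_const _) (integrable_const _), integral_div]
    simp only [integral_const, probReal_univ, smul_eq_mul, one_mul]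
    gcongr
    rw [div_le_iff₀ hn0]
    linarith
  refine tendstoStdGaussian_of_tendsto_integral_cexp hZm fun t => ?_
  have hW : Tendsto (fun n => ∫ ω, Complex.exp ((t * W n ω : ℝ) * Complex.I) ∂μ) atTop
      (𝓝 (Complex.exp (-(t ^ 2 / 2 : ℝ)))) := by
    have h1 := hclt (t * σ⁻¹)
    have e1 : (t * σ⁻¹) ^ 2 * σU2 / 2 = t ^ 2 / 2 := by
      rw [← hσ2]
      field_simp
    rw [e1] at h1
    simpa only [W, mul_assoc] using h1
  have hdiff : Tendsto (fun n => ∫ ω, Complex.exp ((t * Z n ω : ℝ) * Complex.I) ∂μ -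
      ∫ ω, Complex.exp ((t * W n ω : ℝ) * Complex.I) ∂μ) atTop (𝓝 0) := by
    have h1 : Tendsto (fun n : ℕ => |t| * (2 / (σ * √n) * (K + |θ| + (|φ 0| + C₁)))) atTop
        (𝓝 0) := by
      have h2 : Tendsto (fun n : ℕ => σ * √(n : ℝ)) atTop atTop :=
        (Real.tendsto_sqrt_atTop.comp tendsto_natCast_atTop_atTop).const_mul_atTop hσ
      simpa using ((h2.const_div_atTop 2).mul_const (K + |θ| + (|φ 0| + C₁))).const_mul |t|
    refine squeeze_zero_norm' ?_ h1
    filter_upwards [eventually_ge_atTop 2] with n hn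
    obtain ⟨h2, h3⟩ := hZW n hn
    have h4 : ∀ ω, |t * Z n ω - t * W n ω| = |t| * |Z n ω - W n ω| := fun ω => by
      rw [← mul_sub, abs_mul]
    have h5 : Integrable (fun ω => |t * Z n ω - t * W n ω|) μ := by
      simp_rw [h4]
      exact h2.const_mul _
    refine (norm_integral_cexp_sub_le ((hZm n).const_mul t) ((hWm n).const_mul t) h5).trans ?_
    simp_rw [h4]
    rw [integral_const_mul]
    gcongr
  simpa using hdiff.add hW
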